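/- Fix 0 < c ≤ M and let (ρ, m) ∈ L^∞([0,T] × ℝ; K) be an entropy solution in K of the isentropic Euler system with γ = 3, with Riemann invariants w and z. Then there exist locally finite signed Radon measures μ0, σ0 on (0,T) × ℝ × ℝ and locally finite measures μ1, σ1 each of definite sign (each one is either a nonnegative measure or a nonpositive measure) such that ∂_t χ + v ∂_x χ = μ0 + ∂_v μ1 in D'((0,T)×ℝ×ℝ), where χ(t,x,v) = 1 if v ≤ z(t,x) and 0 otherwise, and ∂_t ψ + v ∂_x ψ = σ0 + ∂_v σ1 in D'((0,T)×ℝ×ℝ), where ψ(t,x,v) = 1 if v ≤ w(t,x) and 0 otherwise. -/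

import Mathlib

open MeasureTheory Topology Filter Set
open scoped ENNReal NNReal

noncomputable section

/-- A locally finite signed Radon measure, represented by its (unique) Jordan
decomposition: a mutually singular pair of locally finite positive measures. -/
structure LocSigned (X : Type*) [TopologicalSpace X] [MeasurableSpace X] where
  pos : Measure X
  neg : Measure X
  posLF : IsLocallyFiniteMeasure pos
  negLF : IsLocallyFiniteMeasure neg
  sing : Measure.MutuallySingular pos neg

namespace LocSigned

variable {X : Type*} [TopologicalSpace X] [MeasurableSpace X]

/-- Integral of a function against a signed measure. -/
def integral (μ : LocSigned X) (φ : X → ℝ) : ℝ :=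
  (∫ x, φ x ∂μ.pos) - ∫ x, φ x ∂μ.neg

/-- Total variation measure `|μ|`. -/
def tv (μ : LocSigned X) : Measure X := μ.pos + μ.neg

end LocSigned

/-- Smooth real test functions compactly supported in `Ω`. -/
def IsTestFun {E : Type*} [NormedAddCommGroup E] [NormedSpace ℝ E]
    (Ω : Set E) (φ : E → ℝ) : Prop :=
  ContDiff ℝ (⊤ : ℕ∞) φ ∧ HasCompactSupport φ ∧ tsupport φ ⊆ Ω

/-- The compact state space `K = {(ρ,m) : |(ρ,m)| ≤ M, ρ ≥ c}`. -/
def Kset (c M : ℝ) : Set (ℝ × ℝ) := {p | ‖p‖ ≤ M ∧ c ≤ p.1}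

/-- The time-slab `Ω = (0,T) × ℝ`. -/
def Slab1 (T : ℝ) : Set (ℝ × ℝ) := {p | p.1 ∈ Set.Ioo 0 T}

/-- The slab `(0,T) × ℝ × ℝ` in kinetic variables. -/
def SlabExt1 (T : ℝ) : Set (ℝ × ℝ × ℝ) := {p | p.1 ∈ Set.Ioo 0 T}

/-- The projection `p_{t,x}(t,x,v) = (t,x)`. -/
def projTX1 : ℝ × ℝ × ℝ → ℝ × ℝ := fun p => (p.1, p.2.1)

/-- The flux of the isentropic Euler system with `γ = 3`:
`f(ρ, m) = (m, m²/ρ + ρ³/3)`. -/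
def eulerFlux : ℝ × ℝ → ℝ × ℝ := fun p => (p.2, p.2 ^ 2 / p.1 + p.1 ^ 3 / 3)

/-- `U = (ρ, m)` is an entropy solution in `K` of the isentropic Euler system with
`γ = 3` on `(0,T) × ℝ`: a distributional solution dissipating every convex `C²`
entropy on `K`. -/
def IsEntropySolK (c M T : ℝ) (U : ℝ × ℝ → ℝ × ℝ) : Prop :=
  Measurable U ∧ (∀ p, U p ∈ Kset c M) ∧
  (∀ φ : ℝ × ℝ → ℝ, IsTestFun (Slab1 T) φ →
    (∫ p in Slab1 T,
      ((U p).1 * fderiv ℝ φ p (1, 0) + (U p).2 * fderiv ℝ φ p (0, 1))) = 0 ∧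
    (∫ p in Slab1 T,
      ((U p).2 * fderiv ℝ φ p (1, 0)
        + ((U p).2 ^ 2 / (U p).1 + (U p).1 ^ 3 / 3) * fderiv ℝ φ p (0, 1))) = 0) ∧
  (∀ η Q : ℝ × ℝ → ℝ,
    ContDiffOn ℝ 2 η (Kset c M) → ConvexOn ℝ (Kset c M) η →
    ContDiffOn ℝ 2 Q (Kset c M) →
    (∀ p ∈ Kset c M,
      fderivWithin ℝ Q (Kset c M) p
        = (fderivWithin ℝ η (Kset c M) p).comp (fderiv ℝ eulerFlux p)) →
    ∀ φ : ℝ × ℝ → ℝ, IsTestFun (Slab1 T) φ → (∀ p, 0 ≤ φ p) →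
      0 ≤ ∫ p in Slab1 T,
        (η (U p) * fderiv ℝ φ p (1, 0) + Q (U p) * fderiv ℝ φ p (0, 1)))

/-- The first Riemann invariant `w = m/ρ - ρ`. -/
def wInv (U : ℝ × ℝ → ℝ × ℝ) (p : ℝ × ℝ) : ℝ := (U p).2 / (U p).1 - (U p).1

/-- The second Riemann invariant `z = m/ρ + ρ`. -/
def zInv (U : ℝ × ℝ → ℝ × ℝ) (p : ℝ × ℝ) : ℝ := (U p).2 / (U p).1 + (U p).1

section TestFun

variable {E : Type*} [NormedAddCommGroup E] [NormedSpace ℝ E]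

theorem IsTestFun.mono {Ω Ω' : Set E} (h : Ω ⊆ Ω') {φ : E → ℝ} (hφ : IsTestFun Ω φ) :
    IsTestFun Ω' φ :=
  ⟨hφ.1, hφ.2.1, hφ.2.2.trans h⟩

theorem IsTestFun.continuous {Ω : Set E} {φ : E → ℝ} (hφ : IsTestFun Ω φ) : Continuous φ :=
  hφ.1.continuous

theorem IsTestFun.differentiable {Ω : Set E} {φ : E → ℝ} (hφ : IsTestFun Ω φ) :
    Differentiable ℝ φ :=
  hφ.1.differentiable (by simp)

theorem IsTestFun.eq_zero_of_notMem {Ω : Set E} {φ : E → ℝ} (hφ : IsTestFun Ω φ) {x : E}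
    (hx : x ∉ Ω) : φ x = 0 :=
  image_eq_zero_of_notMem_tsupport fun h => hx (hφ.2.2 h)

theorem IsTestFun.fderiv_apply {Ω : Set E} {φ : E → ℝ} (hφ : IsTestFun Ω φ) (e : E) :
    IsTestFun Ω (fun x => fderiv ℝ φ x e) :=
  ⟨(hφ.1.fderiv_right (m := (⊤ : ℕ∞)) (by simp)).clm_apply contDiff_const,
    hφ.2.1.fderiv_apply (𝕜 := ℝ) e, (tsupport_fderiv_apply_subset ℝ e).trans hφ.2.2⟩

theorem IsTestFun.mul_left {Ω : Set E} {φ : E → ℝ} (hφ : IsTestFun Ω φ) {g : E → ℝ}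
    (hg : ContDiff ℝ (⊤ : ℕ∞) g) : IsTestFun Ω (fun x => g x * φ x) :=
  ⟨hg.mul hφ.1, hφ.2.1.mul_left, (tsupport_mul_subset_right).trans hφ.2.2⟩

theorem IsTestFun.add {Ω : Set E} {φ ψ : E → ℝ} (hφ : IsTestFun Ω φ) (hψ : IsTestFun Ω ψ) :
    IsTestFun Ω (φ + ψ) :=
  ⟨hφ.1.add hψ.1, hφ.2.1.add hψ.2.1, (tsupport_add φ ψ).trans (union_subset hφ.2.2 hψ.2.2)⟩

theorem exists_testFun_dominating [FiniteDimensional ℝ E] (y : E → ℝ) (hy : Continuous y)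
    (hc : HasCompactSupport y) :
    ∃ φ : E → ℝ, IsTestFun Set.univ φ ∧ ∀ x, |y x| ≤ φ x := by
  obtain ⟨B, hB⟩ := hc.exists_bound_of_continuous hy
  obtain ⟨R, hR0, hR⟩ := hc.isBounded.subset_closedBall_lt 0 (0 : E)
  let b : ContDiffBump (0 : E) := ⟨R, R + 1, hR0, by linarith⟩
  refine ⟨fun x => |B| * b x, ⟨contDiff_const.mul b.contDiff, b.hasCompactSupport.mul_left,
    subset_univ _⟩, fun x => ?_⟩
  beta_reduce
  by_cases hx : x ∈ tsupport y
  · rw [b.one_of_mem_closedBall (hR hx), mul_one]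
    exact (hB x).trans (le_abs_self B)
  · rw [image_eq_zero_of_notMem_tsupport hx, abs_zero]
    exact mul_nonneg (abs_nonneg _) b.nonneg

variable [MeasurableSpace E] [BorelSpace E] {μ : Measure E}

theorem IsTestFun.integrable [IsFiniteMeasureOnCompacts μ] {Ω : Set E} {φ : E → ℝ}
    (hφ : IsTestFun Ω φ) : Integrable φ μ :=
  hφ.continuous.integrable_of_hasCompactSupport hφ.2.1

/-- A bounded measurable weight keeps a test function integrable. -/
theorem IsTestFun.integrable_mul [IsFiniteMeasureOnCompacts μ] {Ω : Set E} {φ : E → ℝ}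
    (hφ : IsTestFun Ω φ) {g : E → ℝ} (hg : Measurable g) {B : ℝ}
    (hB : ∀ x ∈ tsupport φ, |g x| ≤ B) : Integrable (fun x => g x * φ x) μ := by
  refine Integrable.mono' (g := fun x => B * |φ x|) (hφ.integrable.abs.const_mul B)
    (hg.aestronglyMeasurable.mul hφ.continuous.aestronglyMeasurable) (ae_of_all _ fun x => ?_)
  rw [Real.norm_eq_abs, abs_mul]
  by_cases hx : x ∈ tsupport φ
  · exact mul_le_mul_of_nonneg_right (hB x hx) (abs_nonneg _)
  · simp [image_eq_zero_of_notMem_tsupport hx]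

variable [FiniteDimensional ℝ E]

theorem integral_fderiv_apply_eq_zero [μ.IsAddHaarMeasure] {φ : E → ℝ} (hφ : ContDiff ℝ 1 φ)
    (hc : HasCompactSupport φ) (e : E) : ∫ x, fderiv ℝ φ x e ∂μ = 0 := by
  have hd : Integrable (fun x => fderiv ℝ φ x e) μ :=
    ((hφ.continuous_fderiv (by simp)).clm_apply continuous_const).integrable_of_hasCompactSupport
      (hc.fderiv_apply (𝕜 := ℝ) e)
  have h := integral_mul_fderiv_eq_neg_fderiv_mul_of_integrable (μ := μ) (𝕜 := ℝ)
    (f := fun _ : E => (1 : ℝ)) (g := φ) (v := e) (by simp) (by simpa using hd)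
    (by simpa using hφ.continuous.integrable_of_hasCompactSupport hc) (by simp)
    (fun x _ => hφ.differentiable (by simp) x)
  simpa using h

/-- A functional on smooth compactly supported functions which is linear and nonnegative on
nonnegative functions is integration against a locally finite measure. -/
theorem exists_measure_integral_eq (Λ : (E → ℝ) → ℝ)
    (hadd : ∀ f g, IsTestFun Set.univ f → IsTestFun Set.univ g → Λ (f + g) = Λ f + Λ g)
    (hsmul : ∀ (a : ℝ) f, IsTestFun Set.univ f → Λ (a • f) = a * Λ f)
    (hnn : ∀ f, IsTestFun Set.univ f → (∀ x, 0 ≤ f x) → 0 ≤ Λ f) :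
    ∃ μ : Measure E, IsLocallyFiniteMeasure μ ∧
      ∀ f, IsTestFun Set.univ f → ∫ x, f x ∂μ = Λ f := by
  have key : ∀ f : CompactlySupportedContinuousMap E ℝ, ContDiff ℝ (⊤ : ℕ∞) f →
      IsTestFun Set.univ (f : E → ℝ) := fun f hf => ⟨hf, f.2, subset_univ _⟩
  let p : Submodule ℝ (CompactlySupportedContinuousMap E ℝ) :=
    { carrier := {f | ContDiff ℝ (⊤ : ℕ∞) f}
      zero_mem' := by
        change ContDiff ℝ (⊤ : ℕ∞) fun _ : E => (0 : ℝ)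
        exact contDiff_const
      add_mem' := fun {f g} (hf : ContDiff ℝ (⊤ : ℕ∞) f) (hg : ContDiff ℝ (⊤ : ℕ∞) g) => by
        change ContDiff ℝ (⊤ : ℕ∞) fun x => f x + g x
        exact hf.add hg
      smul_mem' := fun a f (hf : ContDiff ℝ (⊤ : ℕ∞) f) => by
        change ContDiff ℝ (⊤ : ℕ∞) fun x => a * f x
        exact contDiff_const.mul hf }
  let F : CompactlySupportedContinuousMap E ℝ →ₗ.[ℝ] ℝ :=
    { domain := p
      toFun :=
        { toFun := fun f => Λ f.1
          map_add' := fun f g => hadd _ _ (key _ f.2) (key _ g.2)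
          map_smul' := fun a f => hsmul a _ (key _ f.2) } }
  let s : PointedCone ℝ (CompactlySupportedContinuousMap E ℝ) :=
    { carrier := {f | ∀ x, 0 ≤ f x}
      zero_mem' := fun _ => le_rfl
      add_mem' := fun {f g} hf hg x => add_nonneg (hf x) (hg x)
      smul_mem' := fun a f hf x => mul_nonneg a.2 (hf x) }
  obtain ⟨g, hg, hgs⟩ := riesz_extension s F (fun f hf => hnn _ (key _ f.2) hf) (fun y => by
    obtain ⟨φ, hφ, hle⟩ := exists_testFun_dominating y y.1.2 y.2
    refine ⟨⟨⟨⟨φ, hφ.continuous⟩, hφ.2.1⟩, hφ.1⟩, fun x => ?_⟩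
    have := neg_abs_le (y x)
    have := hle x
    change 0 ≤ φ x + y x
    linarith)
  let G : CompactlySupportedContinuousMap E ℝ →ₚ[ℝ] ℝ :=
    PositiveLinearMap.mk₀ g (fun f hf => hgs f hf)
  refine ⟨RealRMK.rieszMeasure G, inferInstance, fun f hf => ?_⟩
  have := RealRMK.integral_rieszMeasure G ⟨⟨f, hf.continuous⟩, hf.2.1⟩
  refine this.trans ?_
  exact hg ⟨⟨⟨f, hf.continuous⟩, hf.2.1⟩, hf.1⟩

end TestFun

section Entropies

/-- The mechanical energy, a uniformly convex entropy of the system. -/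
def eulerEnergy (p : ℝ × ℝ) : ℝ := p.2 ^ 2 / (2 * p.1) + p.1 ^ 3 / 6

/-- The flux of the mechanical energy. -/
def eulerEnergyFlux (p : ℝ × ℝ) : ℝ := p.2 ^ 3 / (2 * p.1 ^ 2) + p.2 * p.1 ^ 2 / 2

/-- The Riemann invariant `m/ρ + κρ`, which is `z` for `κ = 1` and `w` for `κ = -1`. -/
def riemannInv (κ : ℝ) (p : ℝ × ℝ) : ℝ := p.2 / p.1 + κ * p.1

theorem convexOn_of_supporting {s : Set (ℝ × ℝ)} (hs : Convex ℝ s) {f : ℝ × ℝ → ℝ}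
    (h : ∀ p ∈ s, ∃ α β : ℝ, ∀ q ∈ s, f p + α * (q.1 - p.1) + β * (q.2 - p.2) ≤ f q) :
    ConvexOn ℝ s f := by
  refine ⟨hs, fun x hx y hy a b ha hb hab => ?_⟩
  obtain ⟨α, β, hle⟩ := h _ (hs hx hy ha hb hab)
  have h1 := mul_le_mul_of_nonneg_left (hle x hx) ha
  have h2 := mul_le_mul_of_nonneg_left (hle y hy) hb
  simp only [Prod.fst_add, Prod.snd_add, Prod.smul_fst, Prod.smul_snd, smul_eq_mul] at h1 h2 ⊢
  obtain rfl : b = 1 - a := by linarith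
  linarith

theorem convex_Kset (c M : ℝ) : Convex ℝ (Kset c M) := by
  have h : Kset c M = Metric.closedBall 0 M ∩ (LinearMap.fst ℝ ℝ ℝ) ⁻¹' Set.Ici c := by
    ext p; simp [Kset]
  rw [h]
  exact (convex_closedBall _ _).inter ((convex_Ici c).linear_preimage _)

theorem uniqueDiffOn_Kset {c M : ℝ} (hc : 0 < c) (hcM : c < M) : UniqueDiffOn ℝ (Kset c M) := by
  refine uniqueDiffOn_convex (convex_Kset c M) ⟨((c + M) / 2, 0), ?_⟩
  have hsub : Set.Ioo c M ×ˢ Set.Ioo (-M) M ⊆ Kset c M := by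
    rintro ⟨x, y⟩ ⟨hx, hy⟩
    simp only [Set.mem_Ioo] at hx hy
    refine ⟨max_le ?_ ?_, hx.1.le⟩
    · rw [Real.norm_eq_abs, abs_le]; constructor <;> linarith
    · rw [Real.norm_eq_abs, abs_le]; constructor <;> linarith
  refine interior_maximal hsub (isOpen_Ioo.prod isOpen_Ioo) ⟨⟨?_, ?_⟩, ?_, ?_⟩ <;>
    simp only <;> linarith

theorem entropy_supporting {c C κ : ℝ} (hc : 0 < c) (hC : 1 ≤ C * c ^ 2) {A : ℝ → ℝ} {a : ℝ}
    {p q : ℝ × ℝ} (hp : c ≤ p.1) (hq : c ≤ q.1) (ha0 : 0 ≤ a) (ha1 : a ≤ 1)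
    (hA : A (riemannInv κ p) + a * (riemannInv κ q - riemannInv κ p) ≤ A (riemannInv κ q)) :
    A (riemannInv κ p) + C * eulerEnergy p
      + (a * (κ - p.2 / p.1 ^ 2) + C * (p.1 ^ 2 / 2 - p.2 ^ 2 / (2 * p.1 ^ 2))) * (q.1 - p.1)
      + (a / p.1 + C * (p.2 / p.1)) * (q.2 - p.2) ≤ A (riemannInv κ q) + C * eulerEnergy q := by
  obtain ⟨ρ₀, m₀⟩ := p
  obtain ⟨ρ, m⟩ := q
  simp only [riemannInv, eulerEnergy] at *
  have h0 : 0 < ρ₀ := hc.trans_le hp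
  have h1 : 0 < ρ := hc.trans_le hq
  obtain ⟨u₀, rfl⟩ : ∃ u, m₀ = u * ρ₀ := ⟨m₀ / ρ₀, by field_simp⟩
  obtain ⟨u, rfl⟩ : ∃ v, m = v * ρ := ⟨m / ρ, by field_simp⟩
  rw [mul_div_cancel_right₀ _ h0.ne', mul_div_cancel_right₀ _ h1.ne'] at *
  have hD : 0 < c⁻¹ := inv_pos.2 hc
  have hCpos : 0 < C := by
    by_contra h
    nlinarith [mul_nonneg (sub_nonneg.2 (not_lt.1 h)) (sq_nonneg c)]
  have hCc : c⁻¹ ≤ C * c := by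
    rw [inv_le_iff_one_le_mul₀ hc]; linarith [hC]
  have haD : a / ρ₀ ≤ c⁻¹ := by
    rw [div_eq_mul_inv]
    calc a * ρ₀⁻¹ ≤ 1 * c⁻¹ := mul_le_mul ha1 (inv_anti₀ hc hp) (by positivity) zero_le_one
      _ = c⁻¹ := one_mul _
  have hCρ : c⁻¹ ≤ C * ρ := hCc.trans (mul_le_mul_of_nonneg_left hq hCpos.le)
  have hCρ₀ : c⁻¹ ≤ C * ρ₀ := hCc.trans (mul_le_mul_of_nonneg_left hp hCpos.le)
  have had : 0 ≤ a / ρ₀ := by positivity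
  set x := u - u₀ with hx
  set y := ρ - ρ₀ with hy
  have hxy : a / ρ₀ * (x * y) ≤ c⁻¹ * ((x ^ 2 + y ^ 2) / 2) :=
    calc a / ρ₀ * (x * y) ≤ a / ρ₀ * ((x ^ 2 + y ^ 2) / 2) :=
          mul_le_mul_of_nonneg_left (by nlinarith [sq_nonneg (x - y)]) had
      _ ≤ _ := mul_le_mul_of_nonneg_right haD (by positivity)
  have e1 := mul_le_mul_of_nonneg_right hCρ (sq_nonneg x)
  have e2 := mul_le_mul_of_nonneg_right hCρ (sq_nonneg y)
  have e3 := mul_le_mul_of_nonneg_right hCρ₀ (sq_nonneg y)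
  have key : (A (u + κ * ρ) + C * ((u * ρ) ^ 2 / (2 * ρ) + ρ ^ 3 / 6))
      - (A (u₀ + κ * ρ₀) + C * ((u₀ * ρ₀) ^ 2 / (2 * ρ₀) + ρ₀ ^ 3 / 6)
      + (a * (κ - u₀ * ρ₀ / ρ₀ ^ 2) + C * (ρ₀ ^ 2 / 2 - (u₀ * ρ₀) ^ 2 / (2 * ρ₀ ^ 2))) * y
      + (a / ρ₀ + C * u₀) * (u * ρ - u₀ * ρ₀))
      = (A (u + κ * ρ) - A (u₀ + κ * ρ₀) - a * (u + κ * ρ - (u₀ + κ * ρ₀)))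
        - a / ρ₀ * (x * y) + (C * ρ * x ^ 2 / 2 + C * ρ * y ^ 2 / 6 + C * ρ₀ * y ^ 2 / 3) := by
    rw [hx, hy]
    field_simp
    ring
  linarith

theorem hasFDerivAt_of_partials {f : ℝ × ℝ → ℝ} {L : ℝ × ℝ →L[ℝ] ℝ} {p : ℝ × ℝ} {α β : ℝ}
    (h : HasFDerivAt f L p) (h1 : L (1, 0) = α) (h2 : L (0, 1) = β) :
    HasFDerivAt f (α • ContinuousLinearMap.fst ℝ ℝ ℝ + β • ContinuousLinearMap.snd ℝ ℝ ℝ) p := by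
  convert h using 1
  ext <;> simp [h1, h2]

theorem hasFDerivAt_fun_div {f g : ℝ × ℝ → ℝ} {f' g' : ℝ × ℝ →L[ℝ] ℝ} {p : ℝ × ℝ}
    (hf : HasFDerivAt f f' p) (hg : HasFDerivAt g g' p) (h0 : g p ≠ 0) :
    HasFDerivAt (fun x => f x / g x) ((g p ^ 2)⁻¹ • (g p • f' - f p • g')) p := by
  have h := hf.mul ((hasDerivAt_inv h0).comp_hasFDerivAt p hg)
  have hL : (g p ^ 2)⁻¹ • (g p • f' - f p • g') = f p • -(g p ^ 2)⁻¹ • g' + (g p)⁻¹ • f' := by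
    ext <;> · simp; field_simp; ring
  rw [hL]
  exact h

theorem hasFDerivAt_riemannInv (κ : ℝ) {p : ℝ × ℝ} (hp : p.1 ≠ 0) :
    HasFDerivAt (riemannInv κ) ((κ - p.2 / p.1 ^ 2) • ContinuousLinearMap.fst ℝ ℝ ℝ
      + (1 / p.1) • ContinuousLinearMap.snd ℝ ℝ ℝ) p := by
  refine hasFDerivAt_of_partials
    ((hasFDerivAt_fun_div (hasFDerivAt_snd (p := p)) hasFDerivAt_fst hp).add
      (hasFDerivAt_fst.const_mul κ)) ?_ ?_
  · simp; field_simp; ring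
  · simp; field_simp

theorem hasFDerivAt_eulerEnergy {p : ℝ × ℝ} (hp : p.1 ≠ 0) :
    HasFDerivAt eulerEnergy
      ((p.1 ^ 2 / 2 - p.2 ^ 2 / (2 * p.1 ^ 2)) • ContinuousLinearMap.fst ℝ ℝ ℝ
      + (p.2 / p.1) • ContinuousLinearMap.snd ℝ ℝ ℝ) p := by
  refine hasFDerivAt_of_partials
    ((hasFDerivAt_fun_div ((hasFDerivAt_snd (p := p)).pow 2)
      ((hasFDerivAt_fst (p := p)).const_mul 2) (by simpa using hp)).add
      (hasFDerivAt_fun_div ((hasFDerivAt_fst (p := p)).pow 3)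
          (hasFDerivAt_const (6 : ℝ) p) (by norm_num))) ?_ ?_
  · simp; field_simp; ring
  · simp; field_simp

theorem hasFDerivAt_eulerEnergyFlux {p : ℝ × ℝ} (hp : p.1 ≠ 0) :
    HasFDerivAt eulerEnergyFlux
      ((p.2 * p.1 - p.2 ^ 3 / p.1 ^ 3) • ContinuousLinearMap.fst ℝ ℝ ℝ
      + (3 * p.2 ^ 2 / (2 * p.1 ^ 2) + p.1 ^ 2 / 2) • ContinuousLinearMap.snd ℝ ℝ ℝ) p := by
  refine hasFDerivAt_of_partials
    ((hasFDerivAt_fun_div ((hasFDerivAt_snd (p := p)).pow 3)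
      (((hasFDerivAt_fst (p := p)).pow 2).const_mul 2)
      (by simpa using hp)).add
      (hasFDerivAt_fun_div
        ((hasFDerivAt_snd (p := p)).mul ((hasFDerivAt_fst (p := p)).pow 2))
          (hasFDerivAt_const (2 : ℝ) p)
        (by norm_num))) ?_ ?_
  · simp; field_simp; ring
  · simp; field_simp

theorem fderiv_eulerFlux_apply {p : ℝ × ℝ} (hp : p.1 ≠ 0) (e : ℝ × ℝ) :
    fderiv ℝ eulerFlux p e
      = (e.2, (p.1 ^ 2 - p.2 ^ 2 / p.1 ^ 2) * e.1 + 2 * (p.2 / p.1) * e.2) := by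
  have h : HasFDerivAt (fun p : ℝ × ℝ => p.2 ^ 2 / p.1 + p.1 ^ 3 / 3)
      ((p.1 ^ 2 - p.2 ^ 2 / p.1 ^ 2) • ContinuousLinearMap.fst ℝ ℝ ℝ
        + (2 * (p.2 / p.1)) • ContinuousLinearMap.snd ℝ ℝ ℝ) p := by
    refine hasFDerivAt_of_partials
      ((hasFDerivAt_fun_div ((hasFDerivAt_snd (p := p)).pow 2) hasFDerivAt_fst hp).add
        (hasFDerivAt_fun_div ((hasFDerivAt_fst (p := p)).pow 3)
          (hasFDerivAt_const (3 : ℝ) p) (by norm_num))) ?_ ?_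
    · simp; field_simp; ring
    · simp; field_simp
  have hF : HasFDerivAt eulerFlux _ p := hasFDerivAt_snd.prodMk h
  rw [hF.fderiv]
  simp

theorem contDiffOn_riemannInv {c M : ℝ} (hc : 0 < c) (κ : ℝ) :
    ContDiffOn ℝ 2 (riemannInv κ) (Kset c M) := by
  have h0 : ∀ p ∈ Kset c M, p.1 ≠ 0 := fun p hp => (hc.trans_le hp.2).ne'
  exact (contDiff_snd.contDiffOn.div contDiff_fst.contDiffOn h0).add
    (contDiff_const.mul contDiff_fst).contDiffOn

theorem contDiffOn_eulerEnergy {c M : ℝ} (hc : 0 < c) :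
    ContDiffOn ℝ 2 eulerEnergy (Kset c M) := by
  have h0 : ∀ p ∈ Kset c M, 2 * p.1 ≠ 0 := fun p hp => by simpa using (hc.trans_le hp.2).ne'
  exact ((contDiff_snd.pow 2).contDiffOn.div (contDiff_const.mul contDiff_fst).contDiffOn h0).add
    ((contDiff_fst.pow 3).div_const 6).contDiffOn

theorem contDiffOn_eulerEnergyFlux {c M : ℝ} (hc : 0 < c) :
    ContDiffOn ℝ 2 eulerEnergyFlux (Kset c M) := by
  have h0 : ∀ p ∈ Kset c M, 2 * p.1 ^ 2 ≠ 0 := fun p hp => by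
    simpa using (hc.trans_le hp.2).ne'
  exact ((contDiff_snd.pow 3).contDiffOn.div
    (contDiff_const.mul (contDiff_fst.pow 2)).contDiffOn h0).add
    ((contDiff_snd.mul (contDiff_fst.pow 2)).div_const 2).contDiffOn

/-- Dissipation of the convex entropies `A (m/ρ + κρ) + C · energy`. -/
theorem IsEntropySolK.dissipation_smooth {c M T : ℝ} (hc : 0 < c) (hcM : c < M)
    {U : ℝ × ℝ → ℝ × ℝ} (hU : IsEntropySolK c M T U) {κ : ℝ} (hκ : κ ^ 2 = 1) {C : ℝ}
    (hC : 1 ≤ C * c ^ 2) {A B a : ℝ → ℝ} (hA2 : ContDiff ℝ 2 A) (hB2 : ContDiff ℝ 2 B)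
    (hA : ∀ y, HasDerivAt A (a y) y) (hB : ∀ y, HasDerivAt B (y * a y) y)
    (ha0 : ∀ y, 0 ≤ a y) (ha1 : ∀ y, a y ≤ 1) (hconv : ∀ x y, A x + a x * (y - x) ≤ A y)
    {φ : ℝ × ℝ → ℝ} (hφ : IsTestFun (Slab1 T) φ) (hφ0 : ∀ p, 0 ≤ φ p) :
    0 ≤ ∫ p in Slab1 T,
      ((A (riemannInv κ (U p)) + C * eulerEnergy (U p)) * fderiv ℝ φ p (1, 0)
        + (B (riemannInv κ (U p)) + C * eulerEnergyFlux (U p)) * fderiv ℝ φ p (0, 1)) := by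
  refine hU.2.2.2 (fun p => A (riemannInv κ p) + C * eulerEnergy p)
    (fun p => B (riemannInv κ p) + C * eulerEnergyFlux p)
    ((hA2.comp_contDiffOn (contDiffOn_riemannInv hc κ)).add
      (contDiffOn_const.mul (contDiffOn_eulerEnergy hc)))
    (convexOn_of_supporting (convex_Kset c M) fun p hp => ⟨_, _, fun q hq =>
      entropy_supporting hc hC hp.2 hq.2 (ha0 (riemannInv κ p)) (ha1 _) (hconv _ _)⟩)
    ((hB2.comp_contDiffOn (contDiffOn_riemannInv hc κ)).add
      (contDiffOn_const.mul (contDiffOn_eulerEnergyFlux hc))) (fun p hp => ?_) φ hφ hφ0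
  have h0 : p.1 ≠ 0 := (hc.trans_le hp.2).ne'
  have hr := hasFDerivAt_riemannInv κ h0
  have hη := ((hA _).comp_hasFDerivAt p hr).add ((hasFDerivAt_eulerEnergy h0).const_mul C)
  have hQ := ((hB _).comp_hasFDerivAt p hr).add ((hasFDerivAt_eulerEnergyFlux h0).const_mul C)
  have hu := uniqueDiffOn_Kset hc hcM p hp
  refine ((hQ.hasFDerivWithinAt (s := Kset c M)).fderivWithin hu).trans ?_
  refine Eq.trans ?_ (congrArg (fun L : ℝ × ℝ →L[ℝ] ℝ => L.comp (fderiv ℝ eulerFlux p))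
    ((hη.hasFDerivWithinAt (s := Kset c M)).fderivWithin hu).symm)
  generalize a (riemannInv κ p) = α
  ext
  · simp [fderiv_eulerFlux_apply h0, riemannInv]
    field_simp
    linear_combination p.1 ^ 4 * α * hκ
  · simp [fderiv_eulerFlux_apply h0, riemannInv]
    field_simp
    ring

end Entropies

section Approximation

/-- A smooth convex approximation of the positive part. -/
def sqrtEntropy (ε y : ℝ) : ℝ := (y + √(y ^ 2 + ε ^ 2)) / 2

/-- A primitive of `y` times the derivative of `sqrtEntropy ε`. -/
def sqrtFlux (ε y : ℝ) : ℝ := y ^ 2 / 4 + (y * √(y ^ 2 + ε ^ 2) - ε ^ 2 * Real.arsinh (y / ε)) / 4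

/-- The derivative of `sqrtEntropy ε`. -/
def sqrtSlope (ε y : ℝ) : ℝ := (1 + y / √(y ^ 2 + ε ^ 2)) / 2

variable {ε : ℝ}

theorem contDiff_sqrt_sq_add (hε : 0 < ε) : ContDiff ℝ 2 fun y : ℝ => √(y ^ 2 + ε ^ 2) :=
  ((contDiff_id.pow 2).add contDiff_const).sqrt fun y => by
    have : 0 < y ^ 2 + ε ^ 2 := by positivity
    exact this.ne'

theorem contDiff_sqrtEntropy (hε : 0 < ε) : ContDiff ℝ 2 (sqrtEntropy ε) :=
  (contDiff_id.add (contDiff_sqrt_sq_add hε)).div_const 2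

theorem contDiff_sqrtFlux (hε : 0 < ε) : ContDiff ℝ 2 (sqrtFlux ε) :=
  ((contDiff_id.pow 2).div_const 4).add (((contDiff_id.mul (contDiff_sqrt_sq_add hε)).sub
    (contDiff_const.mul (Real.contDiff_arsinh.comp (contDiff_id.div_const ε)))).div_const 4)

theorem hasDerivAt_sqrt_sq_add (hε : 0 < ε) (y : ℝ) :
    HasDerivAt (fun y : ℝ => √(y ^ 2 + ε ^ 2)) (y / √(y ^ 2 + ε ^ 2)) y := by
  have h0 : 0 < y ^ 2 + ε ^ 2 := by positivity
  refine (((hasDerivAt_pow 2 y).add_const (ε ^ 2)).sqrt h0.ne').congr_deriv ?_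
  have hq : 0 < √(y ^ 2 + ε ^ 2) := Real.sqrt_pos.2 h0
  push_cast
  field_simp

theorem hasDerivAt_sqrtEntropy (hε : 0 < ε) (y : ℝ) :
    HasDerivAt (sqrtEntropy ε) (sqrtSlope ε y) y :=
  ((hasDerivAt_id y).add (hasDerivAt_sqrt_sq_add hε y)).div_const 2

theorem hasDerivAt_sqrtFlux (hε : 0 < ε) (y : ℝ) :
    HasDerivAt (sqrtFlux ε) (y * sqrtSlope ε y) y := by
  have h0 : 0 < y ^ 2 + ε ^ 2 := by positivity
  have hq : 0 < √(y ^ 2 + ε ^ 2) := Real.sqrt_pos.2 h0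
  have h1 : HasDerivAt (sqrtFlux ε) _ y := ((hasDerivAt_pow 2 y).div_const 4).add
    (((((hasDerivAt_id' y).mul (hasDerivAt_sqrt_sq_add hε y))).sub
      (((hasDerivAt_id' y).div_const ε).arsinh.const_mul (ε ^ 2))).div_const 4)
  refine h1.congr_deriv ?_
  have hs : √(1 + (y / ε) ^ 2) = √(y ^ 2 + ε ^ 2) / ε := by
    rw [Real.sqrt_eq_iff_mul_self_eq (by positivity) (by positivity)]
    field_simp
    rw [Real.sq_sqrt h0.le]
    ring
  rw [hs, sqrtSlope, smul_eq_mul]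
  push_cast
  set q := √(y ^ 2 + ε ^ 2) with hqd
  have hqq : q ^ 2 = y ^ 2 + ε ^ 2 := Real.sq_sqrt h0.le
  field_simp
  linear_combination 2 * hqq

theorem abs_le_sqrt_sq_add (ε y : ℝ) : |y| ≤ √(y ^ 2 + ε ^ 2) :=
  Real.abs_le_sqrt (by nlinarith [sq_nonneg ε])

theorem sqrt_sq_add_le (h0 : 0 ≤ ε) (h1 : ε ≤ 1) (y : ℝ) : √(y ^ 2 + ε ^ 2) ≤ |y| + 1 := by
  rw [Real.sqrt_le_left (by positivity)]
  nlinarith [abs_nonneg y, sq_abs y]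

theorem sqrtSlope_nonneg (hε : 0 < ε) (y : ℝ) : 0 ≤ sqrtSlope ε y := by
  have hq : 0 < √(y ^ 2 + ε ^ 2) := Real.sqrt_pos.2 (by positivity)
  have : -1 ≤ y / √(y ^ 2 + ε ^ 2) := by
    rw [le_div_iff₀ hq]
    linarith [neg_abs_le y, abs_le_sqrt_sq_add ε y]
  unfold sqrtSlope
  linarith

theorem sqrtSlope_le_one (hε : 0 < ε) (y : ℝ) : sqrtSlope ε y ≤ 1 := by
  have hq : 0 < √(y ^ 2 + ε ^ 2) := Real.sqrt_pos.2 (by positivity)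
  have : y / √(y ^ 2 + ε ^ 2) ≤ 1 := by
    rw [div_le_one hq]
    linarith [le_abs_self y, abs_le_sqrt_sq_add ε y]
  unfold sqrtSlope
  linarith

theorem sqrtEntropy_supporting (hε : 0 < ε) (x y : ℝ) :
    sqrtEntropy ε x + sqrtSlope ε x * (y - x) ≤ sqrtEntropy ε y := by
  have hx : 0 < x ^ 2 + ε ^ 2 := by positivity
  have hy : 0 < y ^ 2 + ε ^ 2 := by positivity
  have hq := Real.sqrt_pos.2 hx
  have hqq := Real.sq_sqrt hx.le
  have hle : ε ^ 2 + x * y ≤ √(x ^ 2 + ε ^ 2) * √(y ^ 2 + ε ^ 2) := by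
    rw [← Real.sqrt_mul hx.le]
    exact Real.le_sqrt_of_sq_le (by nlinarith [sq_nonneg (ε * (x - y))])
  have hk : √(x ^ 2 + ε ^ 2) + x / √(x ^ 2 + ε ^ 2) * (y - x) ≤ √(y ^ 2 + ε ^ 2) := by
    rw [← sub_nonneg]
    have : √(y ^ 2 + ε ^ 2) - (√(x ^ 2 + ε ^ 2) + x / √(x ^ 2 + ε ^ 2) * (y - x))
      = (√(x ^ 2 + ε ^ 2) * √(y ^ 2 + ε ^ 2) - (ε ^ 2 + x * y)) / √(x ^ 2 + ε ^ 2) := by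
      field_simp
      linear_combination (-1) * hqq
    rw [this]
    exact div_nonneg (by linarith) hq.le
  unfold sqrtEntropy sqrtSlope
  linarith

theorem abs_sqrtEntropy_le (h0 : 0 < ε) (h1 : ε ≤ 1) (y : ℝ) : |sqrtEntropy ε y| ≤ |y| + 1 := by
  have h2 := sqrt_sq_add_le h0.le h1 y
  have h3 := Real.sqrt_nonneg (y ^ 2 + ε ^ 2)
  unfold sqrtEntropy
  rw [abs_le]
  constructor <;> linarith [neg_abs_le y, le_abs_self y]

theorem abs_sq_mul_arsinh_le (hε : 0 < ε) (y : ℝ) : |ε ^ 2 * Real.arsinh (y / ε)| ≤ ε * |y| := by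
  have key : ∀ t : ℝ, |Real.arsinh t| ≤ |t| := fun t => by
    have hle : ∀ t : ℝ, 0 ≤ t → Real.arsinh t ≤ t := fun t ht => by
      have := Real.self_le_sinh_iff.2 (Real.arsinh_nonneg_iff.2 ht)
      rwa [Real.sinh_arsinh] at this
    rcases le_total 0 t with ht | ht
    · rw [abs_of_nonneg ht, abs_of_nonneg (Real.arsinh_nonneg_iff.2 ht)]
      exact hle t ht
    · rw [abs_of_nonpos ht, ← abs_neg, ← Real.arsinh_neg,
        abs_of_nonneg (Real.arsinh_nonneg_iff.2 (neg_nonneg.2 ht))]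
      exact hle _ (neg_nonneg.2 ht)
  rw [abs_mul, abs_of_pos (by positivity : 0 < ε ^ 2)]
  calc ε ^ 2 * |Real.arsinh (y / ε)| ≤ ε ^ 2 * |y / ε| :=
        mul_le_mul_of_nonneg_left (key _) (by positivity)
    _ = ε * |y| := by rw [abs_div, abs_of_pos hε]; field_simp

theorem abs_sqrtFlux_le (h0 : 0 < ε) (h1 : ε ≤ 1) (y : ℝ) : |sqrtFlux ε y| ≤ y ^ 2 + |y| := by
  have h2 := sqrt_sq_add_le h0.le h1 y
  have h3 := abs_sq_mul_arsinh_le h0 y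
  have h4 : ε * |y| ≤ |y| := mul_le_of_le_one_left (abs_nonneg _) h1
  have h5 : |y * √(y ^ 2 + ε ^ 2)| ≤ y ^ 2 + |y| := by
    rw [abs_mul, abs_of_nonneg (Real.sqrt_nonneg _)]
    calc |y| * √(y ^ 2 + ε ^ 2) ≤ |y| * (|y| + 1) := mul_le_mul_of_nonneg_left h2 (abs_nonneg _)
      _ = y ^ 2 + |y| := by rw [← sq_abs]; ring
  unfold sqrtFlux
  rw [abs_le] at h3 h5 ⊢
  constructor <;> nlinarith [sq_nonneg y, abs_nonneg y]

theorem tendsto_sqrt_sq_add (y : ℝ) {u : ℕ → ℝ} (hu : Tendsto u atTop (𝓝 0)) :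
    Tendsto (fun n => √(y ^ 2 + u n ^ 2)) atTop (𝓝 |y|) := by
  have h := (tendsto_const_nhds (x := y ^ 2)).add (hu.pow 2)
  have h2 := (Real.continuous_sqrt.tendsto _).comp h
  have e : √(y ^ 2 + 0 ^ 2) = |y| := by simp [Real.sqrt_sq_eq_abs]
  rw [← e]
  exact h2

theorem max_zero_eq (y : ℝ) : max y 0 = (y + |y|) / 2 := by
  rcases le_total 0 y with h | h
  · rw [max_eq_left h, abs_of_nonneg h]; ring
  · rw [max_eq_right h, abs_of_nonpos h]; ring

theorem tendsto_sqrtEntropy (y : ℝ) {u : ℕ → ℝ} (hu : Tendsto u atTop (𝓝 0)) :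
    Tendsto (fun n => sqrtEntropy (u n) y) atTop (𝓝 (max y 0)) := by
  rw [max_zero_eq]
  exact (tendsto_const_nhds.add (tendsto_sqrt_sq_add y hu)).div_const 2

theorem tendsto_sqrtFlux (y : ℝ) {u : ℕ → ℝ} (hu : Tendsto u atTop (𝓝 0)) (h0 : ∀ n, 0 < u n) :
    Tendsto (fun n => sqrtFlux (u n) y) atTop (𝓝 (max y 0 ^ 2 / 2)) := by
  have e : max y 0 ^ 2 / 2 = y ^ 2 / 4 + (y * |y| - 0) / 4 := by
    rw [max_zero_eq, div_pow, add_sq, sq_abs]; ring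
  have h : Tendsto (fun n => u n ^ 2 * Real.arsinh (y / u n)) atTop (𝓝 0) := by
    refine squeeze_zero_norm (fun n => abs_sq_mul_arsinh_le (h0 n) y) ?_
    simpa using hu.mul_const |y|
  rw [e]
  exact tendsto_const_nhds.add
    (((tendsto_const_nhds.mul (tendsto_sqrt_sq_add y hu)).sub h).div_const 4)

end Approximation

section Limit

/-- The flux of the scalar entropy `y ↦ max (y - s) 0` for Burgers' equation. -/
def kruzkovFlux (s y : ℝ) : ℝ := s * max (y - s) 0 + max (y - s) 0 ^ 2 / 2

@[fun_prop]
theorem measurable_riemannInv (κ : ℝ) : Measurable (riemannInv κ) := by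
  unfold riemannInv; fun_prop

@[fun_prop]
theorem measurable_eulerEnergy : Measurable eulerEnergy := by
  unfold eulerEnergy; fun_prop

@[fun_prop]
theorem measurable_eulerEnergyFlux : Measurable eulerEnergyFlux := by
  unfold eulerEnergyFlux; fun_prop

theorem exists_bounds_Kset {c M : ℝ} (hc : 0 < c) (κ : ℝ) :
    ∃ B : ℝ, 0 ≤ B ∧ ∀ p ∈ Kset c M,
      |riemannInv κ p| ≤ B ∧ |eulerEnergy p| ≤ B ∧ |eulerEnergyFlux p| ≤ B := by
  have hK : IsCompact (Kset c M) := by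
    have h : Kset c M = Metric.closedBall 0 M ∩ Prod.fst ⁻¹' Set.Ici c := by
      ext p; simp [Kset]
    rw [h]
    exact (isCompact_closedBall _ _).inter_right (isClosed_Ici.preimage continuous_fst)
  obtain ⟨B₁, h₁⟩ := hK.exists_bound_of_continuousOn (contDiffOn_riemannInv hc κ).continuousOn
  obtain ⟨B₂, h₂⟩ := hK.exists_bound_of_continuousOn
    (contDiffOn_eulerEnergy (M := M) hc).continuousOn
  obtain ⟨B₃, h₃⟩ := hK.exists_bound_of_continuousOn
    (contDiffOn_eulerEnergyFlux (M := M) hc).continuousOn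
  have e₁ := le_abs_self B₁
  have e₂ := le_abs_self B₂
  have e₃ := le_abs_self B₃
  refine ⟨|B₁| + |B₂| + |B₃|, by positivity, fun p hp => ⟨?_, ?_, ?_⟩⟩
  · have := h₁ p hp; rw [Real.norm_eq_abs] at this
    linarith [abs_nonneg B₂, abs_nonneg B₃]
  · have := h₂ p hp; rw [Real.norm_eq_abs] at this
    linarith [abs_nonneg B₁, abs_nonneg B₃]
  · have := h₃ p hp; rw [Real.norm_eq_abs] at this
    linarith [abs_nonneg B₂, abs_nonneg B₁]

/-- Dissipation of the entropies `max (m/ρ + κρ - s) 0 + C · energy`. -/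
theorem IsEntropySolK.dissipation_posPart {c M T : ℝ} (hc : 0 < c) (hcM : c < M)
    {U : ℝ × ℝ → ℝ × ℝ} (hU : IsEntropySolK c M T U) {κ : ℝ} (hκ : κ ^ 2 = 1) {C : ℝ}
    (hC : 1 ≤ C * c ^ 2) (s : ℝ)
    {φ : ℝ × ℝ → ℝ} (hφ : IsTestFun (Slab1 T) φ) (hφ0 : ∀ p, 0 ≤ φ p) :
    0 ≤ ∫ p in Slab1 T,
      ((max (riemannInv κ (U p) - s) 0 + C * eulerEnergy (U p)) * fderiv ℝ φ p (1, 0)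
        + (kruzkovFlux s (riemannInv κ (U p)) + C * eulerEnergyFlux (U p))
          * fderiv ℝ φ p (0, 1)) := by
  obtain ⟨B, hB0, hB⟩ := exists_bounds_Kset (M := M) hc κ
  have hUm : Measurable U := hU.1
  set u : ℕ → ℝ := fun n => 1 / ((n : ℝ) + 1) with hu
  have hu0 : ∀ n, 0 < u n := fun n => by positivity
  have hu1 : ∀ n, u n ≤ 1 := fun n => by
    rw [hu]; exact (div_le_one (by positivity)).2 (by linarith [(Nat.cast_nonneg n : (0 : ℝ) ≤ n)])
  have hulim : Tendsto u atTop (𝓝 0) := tendsto_one_div_add_atTop_nhds_zero_nat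
  have hn : ∀ n, 0 ≤ ∫ p in Slab1 T,
      ((sqrtEntropy (u n) (riemannInv κ (U p) - s) + C * eulerEnergy (U p)) * fderiv ℝ φ p (1, 0)
        + ((s * sqrtEntropy (u n) (riemannInv κ (U p) - s)
            + sqrtFlux (u n) (riemannInv κ (U p) - s)) + C * eulerEnergyFlux (U p))
          * fderiv ℝ φ p (0, 1)) := fun n => by
    have hs : ContDiff ℝ 2 fun y : ℝ => y - s := contDiff_id.sub contDiff_const
    have hd : ∀ y, HasDerivAt (fun y => sqrtEntropy (u n) (y - s)) (sqrtSlope (u n) (y - s)) y :=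
      fun y => (hasDerivAt_sqrtEntropy (hu0 n) (y - s)).comp_sub_const y s
    refine hU.dissipation_smooth hc hcM hκ hC (A := fun y => sqrtEntropy (u n) (y - s))
      (B := fun y => s * sqrtEntropy (u n) (y - s) + sqrtFlux (u n) (y - s))
      (a := fun y => sqrtSlope (u n) (y - s))
      ((contDiff_sqrtEntropy (hu0 n)).comp hs)
      ((contDiff_const.mul ((contDiff_sqrtEntropy (hu0 n)).comp hs)).add
        ((contDiff_sqrtFlux (hu0 n)).comp hs)) hd (fun y => ?_)
      (fun y => sqrtSlope_nonneg (hu0 n) _) (fun y => sqrtSlope_le_one (hu0 n) _)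
      (fun x y => ?_) hφ hφ0
    · have := ((hd y).const_mul s).add
        ((hasDerivAt_sqrtFlux (hu0 n) (y - s)).comp_sub_const y s)
      exact this.congr_deriv (by ring)
    · have := sqrtEntropy_supporting (hu0 n) (x - s) (y - s)
      rwa [sub_sub_sub_cancel_right] at this
  refine ge_of_tendsto' (tendsto_integral_of_dominated_convergence (fun p =>
    (B + |s| + 1 + |C| * B) * |fderiv ℝ φ p (1, 0)| + ((|s| * (B + |s| + 1)
      + ((B + |s|) ^ 2 + (B + |s|))) + |C| * B) * |fderiv ℝ φ p (0, 1)|)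
    (fun n => ?_) ?_ (fun n => ae_of_all _ fun p => ?_) (ae_of_all _ fun p => ?_)) hn
  · have h1 := (contDiff_sqrtEntropy (hu0 n)).continuous.measurable
    have h2 := (contDiff_sqrtFlux (hu0 n)).continuous.measurable
    have h3 := (hφ.fderiv_apply (1, 0)).continuous.measurable
    have h4 := (hφ.fderiv_apply (0, 1)).continuous.measurable
    exact Measurable.aestronglyMeasurable (by fun_prop)
  · exact (((hφ.fderiv_apply (1, 0)).integrable.abs.const_mul _).add
      ((hφ.fderiv_apply (0, 1)).integrable.abs.const_mul _)).integrableOn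
  · obtain ⟨b1, b2, b3⟩ := hB _ (hU.2.1 p)
    set r := riemannInv κ (U p)
    have hr : |r - s| ≤ B + |s| := (abs_sub r s).trans (by linarith)
    have hA := (abs_sqrtEntropy_le (hu0 n) (hu1 n) (r - s)).trans
      (by linarith : _ ≤ B + |s| + 1)
    have hF := (abs_sqrtFlux_le (hu0 n) (hu1 n) (r - s)).trans
      (add_le_add (sq_le_sq' (by linarith [neg_abs_le (r - s)])
        ((le_abs_self _).trans hr)) hr : _ ≤ (B + |s|) ^ 2 + (B + |s|))
    have hE : |C * eulerEnergy (U p)| ≤ |C| * B := by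
      rw [abs_mul]; exact mul_le_mul_of_nonneg_left b2 (abs_nonneg _)
    have hQ : |C * eulerEnergyFlux (U p)| ≤ |C| * B := by
      rw [abs_mul]; exact mul_le_mul_of_nonneg_left b3 (abs_nonneg _)
    have hsA : |s * sqrtEntropy (u n) (r - s)| ≤ |s| * (B + |s| + 1) := by
      rw [abs_mul]; exact mul_le_mul_of_nonneg_left hA (abs_nonneg _)
    rw [Real.norm_eq_abs]
    refine (abs_add_le _ _).trans (add_le_add ?_ ?_)
    · rw [abs_mul]
      exact mul_le_mul_of_nonneg_right ((abs_add_le _ _).trans (add_le_add hA hE)) (abs_nonneg _)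
    · rw [abs_mul]
      exact mul_le_mul_of_nonneg_right ((abs_add_le _ _).trans
        (add_le_add ((abs_add_le _ _).trans (add_le_add hsA hF)) hQ)) (abs_nonneg _)
  · have h1 := tendsto_sqrtEntropy (riemannInv κ (U p) - s) hulim
    have h2 := tendsto_sqrtFlux (riemannInv κ (U p) - s) hulim hu0
    exact ((h1.add_const _).mul_const _).add
      ((((h1.const_mul s).add h2).add_const _).mul_const _)

end Limit

section TimeCutoff

/-- A smooth nondecreasing approximation of the indicator of `(0, ∞)`. -/
def cutoff (n : ℕ) (t : ℝ) : ℝ := Real.smoothTransition (n * t - 1)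

theorem contDiff_cutoff (n : ℕ) : ContDiff ℝ (⊤ : ℕ∞) (cutoff n) :=
  Real.smoothTransition.contDiff.comp ((contDiff_const.mul contDiff_id).sub contDiff_const)

theorem cutoff_nonneg (n : ℕ) (t : ℝ) : 0 ≤ cutoff n t := Real.smoothTransition.nonneg _

theorem cutoff_le_one (n : ℕ) (t : ℝ) : cutoff n t ≤ 1 := Real.smoothTransition.le_one _

theorem cutoff_of_nonpos (n : ℕ) {t : ℝ} (ht : t ≤ 0) : cutoff n t = 0 :=
  Real.smoothTransition.zero_of_nonpos
    (by nlinarith [(Nat.cast_nonneg n : (0 : ℝ) ≤ n)])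

theorem cutoff_monotone (n : ℕ) : Monotone (cutoff n) := fun s t h =>
  Real.smoothTransition.monotone
    (by have := mul_le_mul_of_nonneg_left h (Nat.cast_nonneg n : (0 : ℝ) ≤ n); linarith)

theorem tendsto_cutoff (t : ℝ) :
    Tendsto (fun n => cutoff n t) atTop (𝓝 (if 0 < t then 1 else 0)) := by
  split_ifs with ht
  · refine tendsto_const_nhds.congr' ?_
    obtain ⟨k, hk⟩ := exists_nat_gt (2 / t)
    filter_upwards [eventually_ge_atTop k] with n hn
    have h1 : (k : ℝ) ≤ n := Nat.cast_le.2 hn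
    have h2 : 2 < n * t := (div_lt_iff₀ ht).1 (hk.trans_le h1)
    exact (Real.smoothTransition.one_of_one_le (by linarith)).symm
  · exact tendsto_const_nhds.congr fun n => (cutoff_of_nonpos n (not_lt.1 ht)).symm

theorem fderiv_comp_fst_mul_apply {F : Type*} [NormedAddCommGroup F] [NormedSpace ℝ F]
    {G : ℝ → ℝ} (hG : Differentiable ℝ G) {ψ : ℝ × F → ℝ} (hψ : Differentiable ℝ ψ)
    (p e : ℝ × F) :
    fderiv ℝ (fun p => G p.1 * ψ p) p e = deriv G p.1 * e.1 * ψ p + G p.1 * fderiv ℝ ψ p e := by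
  have h1 : HasFDerivAt (fun p : ℝ × F => G p.1) (deriv G p.1 • ContinuousLinearMap.fst ℝ ℝ F) p :=
    (hG p.1).hasDerivAt.comp_hasFDerivAt p (hasFDerivAt_fst (𝕜 := ℝ))
  rw [(h1.fun_mul (hψ p).hasFDerivAt).fderiv]
  simp
  ring

/-- A bounded dissipative pair on the slab extends to a dissipative pair on the whole plane when
the entropy is continued by large constants before and after the time interval. -/
theorem integral_timeExtension_nonneg {T N B : ℝ} {a b : ℝ × ℝ → ℝ} (hT : 0 < T)
    (ha : Measurable a) (hb : Measurable b) (haN : ∀ p, |a p| ≤ N) (hbB : ∀ p, |b p| ≤ B)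
    (h : ∀ φ, IsTestFun (Slab1 T) φ → (∀ p, 0 ≤ φ p) →
      0 ≤ ∫ p in Slab1 T, (a p * fderiv ℝ φ p (1, 0) + b p * fderiv ℝ φ p (0, 1)))
    {ψ : ℝ × ℝ → ℝ} (hψ : IsTestFun Set.univ ψ) (hψ0 : ∀ p, 0 ≤ ψ p) :
    0 ≤ ∫ p, ((if p.1 ≤ 0 then N else if p.1 < T then a p else -N) * fderiv ℝ ψ p (1, 0)
      + (if p.1 ∈ Set.Ioo 0 T then b p else 0) * fderiv ℝ ψ p (0, 1)) := by
  have hN : 0 ≤ N := (abs_nonneg _).trans (haN 0)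
  have hB : 0 ≤ B := (abs_nonneg _).trans (hbB 0)
  set g : ℕ → ℝ → ℝ := fun n t => cutoff n t with hg
  set k : ℕ → ℝ → ℝ := fun n t => cutoff n (T - t) with hk
  have hgs : ∀ n, ContDiff ℝ (⊤ : ℕ∞) (g n) := fun n => contDiff_cutoff n
  have hks : ∀ n, ContDiff ℝ (⊤ : ℕ∞) (k n) := fun n =>
    (contDiff_cutoff n).comp (contDiff_const.sub contDiff_id)
  have hχs : ∀ n, ContDiff ℝ (⊤ : ℕ∞) (fun t => g n t * k n t) := fun n => (hgs n).mul (hks n)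
  have hds : ∀ n, ContDiff ℝ (⊤ : ℕ∞) (fun t => k n t - g n t) := fun n => (hks n).sub (hgs n)
  have hψt := hψ.fderiv_apply (1, 0)
  have hψx := hψ.fderiv_apply (0, 1)
  have hfst : ContDiff ℝ (⊤ : ℕ∞) (Prod.fst : ℝ × ℝ → ℝ) := contDiff_fst
  set I : ℕ → ℝ × ℝ → ℝ := fun n p =>
    (a p * (g n p.1 * k n p.1) + N * (k n p.1 - g n p.1)) * fderiv ℝ ψ p (1, 0)
      + b p * (g n p.1 * k n p.1) * fderiv ℝ ψ p (0, 1) with hI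
  have hIm : ∀ n, Measurable (I n) := fun n => by
    have h1 := (hgs n).continuous.measurable
    have h2 := (hks n).continuous.measurable
    have h3 := hψt.continuous.measurable
    have h4 := hψx.continuous.measurable
    fun_prop
  have hg0 : ∀ n t, 0 ≤ g n t := fun n t => cutoff_nonneg _ _
  have hg1 : ∀ n t, g n t ≤ 1 := fun n t => cutoff_le_one _ _
  have hk0 : ∀ n t, 0 ≤ k n t := fun n t => cutoff_nonneg _ _
  have hk1 : ∀ n t, k n t ≤ 1 := fun n t => cutoff_le_one _ _
  have hχ1 : ∀ n t, |g n t * k n t| ≤ 1 := fun n t => by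
    rw [abs_of_nonneg (mul_nonneg (hg0 n t) (hk0 n t))]
    exact mul_le_one₀ (hg1 n t) (hk0 n t) (hk1 n t)
  have hd1 : ∀ n t, |k n t - g n t| ≤ 1 := fun n t => by
    rw [abs_le]
    constructor <;> linarith [hg0 n t, hg1 n t, hk0 n t, hk1 n t]
  have hIb : ∀ n p, ‖I n p‖ ≤
      (N + N) * |fderiv ℝ ψ p (1, 0)| + B * |fderiv ℝ ψ p (0, 1)| := fun n p => by
    have e1 : |a p * (g n p.1 * k n p.1)| ≤ N := by
      rw [abs_mul]; simpa using mul_le_mul (haN p) (hχ1 n p.1) (abs_nonneg _) hN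
    have e2 : |N * (k n p.1 - g n p.1)| ≤ N := by
      rw [abs_mul, abs_of_nonneg hN]; simpa using mul_le_mul_of_nonneg_left (hd1 n p.1) hN
    have e3 : |b p * (g n p.1 * k n p.1)| ≤ B := by
      rw [abs_mul]; simpa using mul_le_mul (hbB p) (hχ1 n p.1) (abs_nonneg _) hB
    rw [Real.norm_eq_abs]
    refine (abs_add_le _ _).trans (add_le_add ?_ ?_)
    · rw [abs_mul]
      exact mul_le_mul_of_nonneg_right ((abs_add_le _ _).trans (add_le_add e1 e2)) (abs_nonneg _)
    · rw [abs_mul]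
      exact mul_le_mul_of_nonneg_right e3 (abs_nonneg _)
  have hbound : Integrable (fun p =>
      (N + N) * |fderiv ℝ ψ p (1, 0)| + B * |fderiv ℝ ψ p (0, 1)|) volume :=
    (hψt.integrable.abs.const_mul _).add (hψx.integrable.abs.const_mul _)
  have hIi : ∀ n, Integrable (I n) volume := fun n =>
    hbound.mono' (hIm n).aestronglyMeasurable (ae_of_all _ (hIb n))
  have hpos : ∀ n, 0 ≤ ∫ p, I n p := fun n => by
    have hχψ : IsTestFun (Slab1 T) (fun p => (fun t => g n t * k n t) p.1 * ψ p) := by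
      have h0 := hψ.mul_left ((hχs n).comp hfst)
      refine ⟨h0.1, h0.2.1, ?_⟩
      have hcl : IsClosed {p : ℝ × ℝ | 1 ≤ n * p.1 ∧ 1 ≤ n * (T - p.1)} :=
        (isClosed_le (f := fun _ : ℝ × ℝ => (1 : ℝ)) (g := fun p => n * p.1) (by fun_prop)
          (by fun_prop)).inter (isClosed_le (f := fun _ : ℝ × ℝ => (1 : ℝ))
          (g := fun p => n * (T - p.1)) (by fun_prop) (by fun_prop))
      refine (closure_minimal (fun p hp => ?_) hcl).trans (fun p hp => ?_)
      · rw [Function.mem_support] at hp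
        by_contra hcon
        rw [mem_ofPred_eq, not_and_or, not_le, not_le] at hcon
        apply hp
        rcases hcon with hcon | hcon
        · have : g n p.1 = 0 := Real.smoothTransition.zero_of_nonpos (by linarith)
          simp [this]
        · have : k n p.1 = 0 := Real.smoothTransition.zero_of_nonpos (by linarith)
          simp [this]
      · obtain ⟨h1, h2⟩ := hp
        have hn : (0 : ℝ) ≤ n := Nat.cast_nonneg n
        constructor <;> by_contra hcon <;> nlinarith
    have hdψ : IsTestFun Set.univ (fun p => (fun t => k n t - g n t) p.1 * ψ p) :=
      hψ.mul_left ((hds n).comp hfst)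
    have hJ := h _ hχψ fun p => mul_nonneg (mul_nonneg (hg0 n _) (hk0 n _)) (hψ0 p)
    have hJt := hχψ.fderiv_apply (1, 0)
    have hJx := hχψ.fderiv_apply (0, 1)
    have hS := integral_fderiv_apply_eq_zero (μ := volume) (hdψ.1.of_le (by simp)) hdψ.2.1 (1, 0)
    rw [setIntegral_eq_integral_of_forall_compl_eq_zero fun p hp => by
      rw [hJt.eq_zero_of_notMem hp, hJx.eq_zero_of_notMem hp, mul_zero, mul_zero, add_zero]] at hJ
    have hJi := (hJt.integrable_mul (μ := volume) ha fun p _ => haN p).add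
      (hJx.integrable_mul (μ := volume) hb fun p _ => hbB p)
    have hSi : Integrable (fun p => N * fderiv ℝ (fun p => (fun t => k n t - g n t) p.1 * ψ p) p
      (1, 0)) volume := (hdψ.fderiv_apply (1, 0)).integrable.const_mul N
    have hsum := integral_add hJi hSi
    rw [integral_const_mul, hS, mul_zero, add_zero] at hsum
    refine (hJ.trans hsum.ge).trans (integral_mono (hJi.add hSi) (hIi n) fun p => ?_)
    have hgd : Differentiable ℝ (g n) := (hgs n).differentiable (by simp)
    have hkd : Differentiable ℝ (k n) := (hks n).differentiable (by simp)
    have hχd : deriv (fun t => g n t * k n t) p.1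
        = deriv (g n) p.1 * k n p.1 + g n p.1 * deriv (k n) p.1 :=
      deriv_fun_mul (hgd _) (hkd _)
    have hdd : deriv (fun t => k n t - g n t) p.1 = deriv (k n) p.1 - deriv (g n) p.1 :=
      deriv_fun_sub (hkd _) (hgd _)
    have hg' : 0 ≤ deriv (g n) p.1 := (cutoff_monotone n).deriv_nonneg
    have hk' : deriv (k n) p.1 ≤ 0 :=
      Antitone.deriv_nonpos fun s t hst => cutoff_monotone n (by linarith)
    simp only [Pi.add_apply]
    rw [fderiv_comp_fst_mul_apply ((hχs n).differentiable (by simp)) hψ.differentiable,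
      fderiv_comp_fst_mul_apply ((hχs n).differentiable (by simp)) hψ.differentiable,
      fderiv_comp_fst_mul_apply ((hds n).differentiable (by simp)) hψ.differentiable, hχd, hdd]
    have e1 : a p * k n p.1 ≤ N := by
      have := mul_le_mul (haN p) (hk1 n p.1) (hk0 n p.1) hN
      rw [mul_one] at this
      exact (mul_le_mul_of_nonneg_right (le_abs_self _) (hk0 n p.1)).trans this
    have e2 : -(a p) * g n p.1 ≤ N := by
      have := mul_le_mul (haN p) (hg1 n p.1) (hg0 n p.1) hN
      rw [mul_one] at this
      exact (mul_le_mul_of_nonneg_right (neg_le_abs _) (hg0 n p.1)).trans this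
    have e3 := mul_nonneg (hψ0 p) (mul_nonneg hg' (sub_nonneg.2 e1))
    have e4 := mul_nonneg (hψ0 p) (mul_nonneg (neg_nonneg.2 hk') (sub_nonneg.2 e2))
    rw [← sub_nonneg]
    have : ∀ x y : ℝ, x = y → 0 ≤ y → 0 ≤ x := fun x y h1 h2 => h1 ▸ h2
    refine this _ _ ?_ (add_nonneg e3 e4)
    simp only [hI]
    ring
  refine ge_of_tendsto' (tendsto_integral_of_dominated_convergence _
    (fun n => (hIm n).aestronglyMeasurable) hbound (fun n => ae_of_all _ (hIb n))
    (ae_of_all _ fun p => ?_)) hpos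
  have hgl : Tendsto (fun n => g n p.1) atTop (𝓝 (if 0 < p.1 then 1 else 0)) := tendsto_cutoff _
  have hkl : Tendsto (fun n => k n p.1) atTop (𝓝 (if 0 < T - p.1 then 1 else 0)) :=
    tendsto_cutoff _
  have hl := ((((hgl.mul hkl).const_mul (a p)).add ((hkl.sub hgl).const_mul N)).mul_const
    (fderiv ℝ ψ p (1, 0))).add (((hgl.mul hkl).const_mul (b p)).mul_const (fderiv ℝ ψ p (0, 1)))
  have hcases : p.1 ≤ 0 ∨ (0 < p.1 ∧ p.1 < T) ∨ T ≤ p.1 := by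
    rcases le_or_gt p.1 0 with h1 | h1
    · exact Or.inl h1
    · rcases lt_or_ge p.1 T with h2 | h2
      · exact Or.inr (Or.inl ⟨h1, h2⟩)
      · exact Or.inr (Or.inr h2)
  convert hl using 2
  rcases hcases with h1 | ⟨h1, h2⟩ | h2
  · simp [h1, not_lt.2 h1, h1.trans_lt hT]
  · simp [h1, h2, not_le.2 h1]
  · have h1 := hT.trans_le h2
    simp [h1, not_le.2 h1, not_lt.2 h2]

end TimeCutoff

section Slicing

theorem integral_eq_integral_lastSlice {F : ℝ × ℝ × ℝ → ℝ} (hF : Integrable F volume) :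
    ∫ p, F p = ∫ s, ∫ q : ℝ × ℝ, F (q.1, q.2, s) := by
  have hm := volume_preserving_prodAssoc (α₁ := ℝ) (β₁ := ℝ) (γ₁ := ℝ)
  rw [← hm.integral_comp' F]
  exact integral_prod_symm _ (hm.integrable_comp_of_integrable hF)

theorem integral_eq_integral_fiber {F : ℝ × ℝ × ℝ → ℝ} (hF : Integrable F volume) :
    ∫ p, F p = ∫ q : ℝ × ℝ, ∫ s, F (q.1, q.2, s) := by
  have hm := volume_preserving_prodAssoc (α₁ := ℝ) (β₁ := ℝ) (γ₁ := ℝ)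
  rw [← hm.integral_comp' F]
  exact integral_prod _ (hm.integrable_comp_of_integrable hF)

theorem hasFDerivAt_lastSlice (s : ℝ) (q : ℝ × ℝ) :
    HasFDerivAt (fun q : ℝ × ℝ => (q.1, q.2, s))
      ((ContinuousLinearMap.fst ℝ ℝ ℝ).prod ((ContinuousLinearMap.snd ℝ ℝ ℝ).prod 0)) q :=
  hasFDerivAt_fst.prodMk (hasFDerivAt_snd.prodMk (hasFDerivAt_const s q))

theorem fderiv_lastSlice_apply {f : ℝ × ℝ × ℝ → ℝ} (hf : Differentiable ℝ f) (s : ℝ)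
    (q e : ℝ × ℝ) :
    fderiv ℝ (fun q : ℝ × ℝ => f (q.1, q.2, s)) q e
      = fderiv ℝ f (q.1, q.2, s) (e.1, e.2, 0) := by
  have h := (hf (q.1, q.2, s)).hasFDerivAt.comp q (hasFDerivAt_lastSlice s q)
  have h2 := h.fderiv
  rw [Function.comp_def] at h2
  rw [h2]
  simp

theorem IsTestFun.lastSlice {S : Set ℝ} {f : ℝ × ℝ × ℝ → ℝ}
    (hf : IsTestFun {p | p.1 ∈ S} f) (s : ℝ) :
    IsTestFun {q : ℝ × ℝ | q.1 ∈ S} fun q => f (q.1, q.2, s) := by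
  have hc : Continuous fun q : ℝ × ℝ => (q.1, q.2, s) := by fun_prop
  have hsub : tsupport (fun q : ℝ × ℝ => f (q.1, q.2, s))
      ⊆ (fun q : ℝ × ℝ => (q.1, q.2, s)) ⁻¹' tsupport f :=
    closure_minimal (fun q hq => subset_tsupport f hq) ((isClosed_tsupport f).preimage hc)
  refine ⟨hf.1.comp (contDiff_fst.prodMk (contDiff_snd.prodMk contDiff_const)), ?_,
    hsub.trans fun q hq => hf.2.2 hq⟩
  refine HasCompactSupport.intro (hf.2.1.isCompact.image (f := projTX1)
    (continuous_fst.prodMk (continuous_fst.comp continuous_snd))) fun q hq => ?_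
  by_contra h0
  exact hq ⟨(q.1, q.2, s), subset_tsupport f h0, rfl⟩

theorem hasDerivAt_fiber {f : ℝ × ℝ × ℝ → ℝ} (hf : Differentiable ℝ f) (q : ℝ × ℝ) (s : ℝ) :
    HasDerivAt (fun s => f (q.1, q.2, s)) (fderiv ℝ f (q.1, q.2, s) (0, 0, 1)) s := by
  have h : HasDerivAt (fun s : ℝ => (q.1, q.2, s)) (0, 0, 1) s :=
    (hasDerivAt_const s q.1).prodMk ((hasDerivAt_const s q.2).prodMk (hasDerivAt_id s))
  exact (hf (q.1, q.2, s)).hasFDerivAt.comp_hasDerivAt s h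

theorem IsTestFun.contDiff_fiber {Ω : Set (ℝ × ℝ × ℝ)} {f : ℝ × ℝ × ℝ → ℝ}
    (hf : IsTestFun Ω f) (q : ℝ × ℝ) : ContDiff ℝ (⊤ : ℕ∞) fun s => f (q.1, q.2, s) :=
  hf.1.comp (contDiff_const.prodMk (contDiff_const.prodMk contDiff_id))

theorem IsTestFun.hasCompactSupport_fiber {Ω : Set (ℝ × ℝ × ℝ)} {f : ℝ × ℝ × ℝ → ℝ}
    (hf : IsTestFun Ω f) (q : ℝ × ℝ) : HasCompactSupport fun s => f (q.1, q.2, s) := by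
  refine HasCompactSupport.intro (hf.2.1.isCompact.image (f := fun p => p.2.2)
    (continuous_snd.comp continuous_snd)) fun s hs => ?_
  by_contra h0
  exact hs ⟨(q.1, q.2, s), subset_tsupport f h0, rfl⟩

theorem fderiv_fderiv_apply_comm {E : Type*} [NormedAddCommGroup E] [NormedSpace ℝ E]
    {f : E → ℝ} (hf : ContDiff ℝ 2 f) (x v w : E) :
    fderiv ℝ (fun y => fderiv ℝ f y v) x w = fderiv ℝ (fun y => fderiv ℝ f y w) x v := by
  have hd : DifferentiableAt ℝ (fderiv ℝ f) x :=
    (hf.fderiv_right (m := 1) (by norm_num)).differentiable (by simp) x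
  have h := (hf.contDiffAt (x := x)).isSymmSndFDerivAt (by simp) v w
  rw [fderiv_clm_apply hd (differentiableAt_const v),
    fderiv_clm_apply hd (differentiableAt_const w)]
  simpa using h.symm

theorem IsTestFun.integrable_mul_of_le {Ω : Set (ℝ × ℝ × ℝ)} {f w : ℝ × ℝ × ℝ → ℝ}
    (hf : IsTestFun Ω f) (hw : Measurable w) {L : ℝ → ℝ} (hL : Continuous L)
    (hwL : ∀ p, |w p| ≤ L p.2.2) : Integrable (fun p => w p * f p) volume := by
  obtain ⟨D, hD⟩ := hf.2.1.isCompact.exists_bound_of_continuousOn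
    (f := fun p => L p.2.2) (by fun_prop)
  exact hf.integrable_mul hw fun p hp => (hwL p).trans ((le_abs_self _).trans (hD p hp))

end Slicing

section Representation

/-- A family of dissipative pairs, depending measurably on a parameter, has a locally finite
dissipation measure in all variables. -/
theorem exists_measure_of_dissipative {T : ℝ} (hT : 0 < T) {a b : ℝ × ℝ × ℝ → ℝ}
    (ha : Measurable a) (hb : Measurable b) {N B : ℝ → ℝ} (hN : Continuous N) (hB : Continuous B)
    (haN : ∀ p, |a p| ≤ N p.2.2) (hbB : ∀ p, |b p| ≤ B p.2.2)
    (h : ∀ s φ, IsTestFun (Slab1 T) φ → (∀ p, 0 ≤ φ p) →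
      0 ≤ ∫ q in Slab1 T, (a (q.1, q.2, s) * fderiv ℝ φ q (1, 0)
        + b (q.1, q.2, s) * fderiv ℝ φ q (0, 1))) :
    ∃ μ : Measure (ℝ × ℝ × ℝ), IsLocallyFiniteMeasure μ ∧
      ∀ φ, IsTestFun (SlabExt1 T) φ →
        ∫ p, φ p ∂μ = ∫ p, (a p * fderiv ℝ φ p (1, 0, 0) + b p * fderiv ℝ φ p (0, 1, 0)) := by
  set a' : ℝ × ℝ × ℝ → ℝ := fun p =>
    if p.1 ≤ 0 then N p.2.2 else if p.1 < T then a p else -N p.2.2 with ha'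
  set b' : ℝ × ℝ × ℝ → ℝ := fun p => if p.1 ∈ Set.Ioo 0 T then b p else 0 with hb'
  have hN0 : ∀ s, 0 ≤ N s := fun s => (abs_nonneg _).trans (haN (0, 0, s))
  have hB0 : ∀ s, 0 ≤ B s := fun s => (abs_nonneg _).trans (hbB (0, 0, s))
  have hfst : Measurable fun p : ℝ × ℝ × ℝ => p.1 := measurable_fst
  have hNm : Measurable fun p : ℝ × ℝ × ℝ => N p.2.2 :=
    hN.measurable.comp (measurable_snd.comp measurable_snd)
  have ham : Measurable a' := Measurable.ite (measurableSet_le hfst measurable_const) hNm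
    (Measurable.ite (measurableSet_lt hfst measurable_const) ha hNm.neg)
  have hbm : Measurable b' := Measurable.ite (hfst measurableSet_Ioo) hb measurable_const
  have haN' : ∀ p, |a' p| ≤ N p.2.2 := fun p => by
    simp only [ha']
    split_ifs
    · rw [abs_of_nonneg (hN0 _)]
    · exact haN p
    · rw [abs_neg, abs_of_nonneg (hN0 _)]
  have hbB' : ∀ p, |b' p| ≤ B p.2.2 := fun p => by
    simp only [hb']
    split_ifs
    · exact hbB p
    · simpa using hB0 _
  have hint : ∀ f, IsTestFun Set.univ f → Integrable
      (fun p => a' p * fderiv ℝ f p (1, 0, 0) + b' p * fderiv ℝ f p (0, 1, 0)) volume :=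
    fun f hf => ((hf.fderiv_apply _).integrable_mul_of_le ham hN haN').add
      ((hf.fderiv_apply _).integrable_mul_of_le hbm hB hbB')
  have hΛ : ∃ μ : Measure (ℝ × ℝ × ℝ), IsLocallyFiniteMeasure μ ∧
      ∀ f, IsTestFun Set.univ f → ∫ p, f p ∂μ
        = ∫ p, (a' p * fderiv ℝ f p (1, 0, 0) + b' p * fderiv ℝ f p (0, 1, 0)) := by
    refine exists_measure_integral_eq _ (fun f g hf hg => ?_) (fun c f hf => ?_)
      (fun f hf hf0 => ?_)
    · rw [← integral_add (hint f hf) (hint g hg)]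
      refine integral_congr_ae (ae_of_all _ fun p => ?_)
      beta_reduce
      rw [fderiv_add (hf.differentiable p) (hg.differentiable p)]
      simp only [_root_.add_apply]
      ring
    · rw [← integral_const_mul]
      refine integral_congr_ae (ae_of_all _ fun p => ?_)
      beta_reduce
      rw [fderiv_const_smul (hf.differentiable p)]
      simp only [_root_.smul_apply, smul_eq_mul]
      ring
    · rw [integral_eq_integral_lastSlice (hint f hf)]
      refine integral_nonneg fun s => ?_
      have hfs : IsTestFun Set.univ fun q : ℝ × ℝ => f (q.1, q.2, s) :=
        IsTestFun.mono (subset_univ _)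
          (IsTestFun.lastSlice (S := Set.univ) (hf.mono fun _ _ => mem_univ _) s)
      have hm : Measurable fun q : ℝ × ℝ => (q.1, q.2, s) := by fun_prop
      have hpos := integral_timeExtension_nonneg (N := N s) (B := B s) hT (ha.comp hm) (hb.comp hm)
        (fun q => haN (q.1, q.2, s)) (fun q => hbB (q.1, q.2, s)) (h s) hfs fun q => hf0 _
      simp only [fderiv_lastSlice_apply hf.differentiable] at hpos
      exact hpos
  obtain ⟨μ, hμ, hμΛ⟩ := hΛ
  refine ⟨μ, hμ, fun φ hφ => ?_⟩
  rw [hμΛ φ (hφ.mono (subset_univ _))]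
  refine integral_congr_ae (ae_of_all _ fun p => ?_)
  by_cases hp : p.1 ∈ Set.Ioo 0 T
  · simp only [ha', hb', if_pos hp, if_neg (not_le.2 hp.1), if_pos hp.2]
  · simp only [(hφ.fderiv_apply (1, 0, 0)).eq_zero_of_notMem hp,
      (hφ.fderiv_apply (0, 1, 0)).eq_zero_of_notMem hp, mul_zero]

theorem integral_posPart_mul_deriv {g k : ℝ → ℝ} (hg : ContDiff ℝ (⊤ : ℕ∞) g)
    (hk : ContDiff ℝ (⊤ : ℕ∞) k) (hgc : HasCompactSupport g) (hkc : HasCompactSupport k)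
    (r C₁ C₂ : ℝ) :
    ∫ s, ((max (r - s) 0 + C₁) * deriv g s + (kruzkovFlux s r + C₂) * deriv k s)
      = ∫ s, (if s ≤ r then 1 else 0) * (g s + s * k s) := by
  set F : ℝ → ℝ := fun s => (r - s) * g s + (r ^ 2 - s ^ 2) / 2 * k s with hF
  set G : ℝ → ℝ := fun s => C₁ * g s + C₂ * k s with hG
  have hFs : ContDiff ℝ 1 F := by
    have h1 := hg.of_le (m := 1) (by simp)
    have h2 := hk.of_le (m := 1) (by simp)
    fun_prop
  have hFc : HasCompactSupport F := hgc.mul_left.add hkc.mul_left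
  have hGs : ContDiff ℝ 1 G := by
    have h1 := hg.of_le (m := 1) (by simp)
    have h2 := hk.of_le (m := 1) (by simp)
    fun_prop
  have hGc : HasCompactSupport G := hgc.mul_left.add hkc.mul_left
  have hgd : ∀ s, HasDerivAt g (deriv g s) s := fun s =>
    (hg.differentiable (by simp) s).hasDerivAt
  have hkd : ∀ s, HasDerivAt k (deriv k s) s := fun s =>
    (hk.differentiable (by simp) s).hasDerivAt
  have hFd : ∀ s, deriv F s = (r - s) * deriv g s + (r ^ 2 - s ^ 2) / 2 * deriv k s
      - (g s + s * k s) := fun s => by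
    have h := ((((hasDerivAt_id' s).const_sub r).mul (hgd s)).add
      ((((hasDerivAt_pow 2 s).const_sub (r ^ 2)).div_const 2).mul (hkd s))).deriv
    refine Eq.trans h ?_
    push_cast
    ring
  have hGd : ∀ s, deriv G s = C₁ * deriv g s + C₂ * deriv k s := fun s =>
    (((hgd s).const_mul C₁).add ((hkd s).const_mul C₂)).deriv
  have hF0 : ∫ s, (Set.Iic r).indicator (deriv F) s = 0 := by
    rw [integral_indicator measurableSet_Iic, hFc.integral_Iic_deriv_eq hFs]
    simp [hF]
  have hG0 : ∫ s, deriv G s = 0 := integral_fderiv_apply_eq_zero hGs hGc 1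
  have hFi : Integrable ((Set.Iic r).indicator (deriv F)) volume :=
    ((hFs.continuous_deriv le_rfl).integrable_of_hasCompactSupport hFc.deriv).indicator
      measurableSet_Iic
  have hGi : Integrable (deriv G) volume :=
    (hGs.continuous_deriv le_rfl).integrable_of_hasCompactSupport hGc.deriv
  have hRi : Integrable (fun s => (if s ≤ r then 1 else 0) * (g s + s * k s)) volume := by
    have h0 : Integrable (fun s => g s + s * k s) volume :=
      (hg.continuous.add (continuous_id.mul hk.continuous)).integrable_of_hasCompactSupport
        (hgc.add hkc.mul_left)
    refine (h0.indicator (measurableSet_Iic (a := r))).congr (ae_of_all _ fun s => ?_)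
    simp [Set.indicator, ite_mul]
  have hsum : ∫ s, ((if s ≤ r then 1 else 0) * (g s + s * k s)
      + (Set.Iic r).indicator (deriv F) s + deriv G s)
      = ∫ s, (if s ≤ r then 1 else 0) * (g s + s * k s) := by
    have h1 := integral_add (hRi.add hFi) hGi
    have h2 := integral_add hRi hFi
    simp only [Pi.add_apply] at h1
    rw [h1, h2, hF0, hG0, add_zero, add_zero]
  rw [← hsum]
  refine integral_congr_ae (ae_of_all _ fun s => ?_)
  beta_reduce
  rw [hGd]
  by_cases hs : s ≤ r
  · rw [Set.indicator_of_mem (show s ∈ Set.Iic r from hs), hFd, if_pos hs, kruzkovFlux,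
      max_eq_left (sub_nonneg.2 hs)]
    ring
  · rw [Set.indicator_of_notMem (show s ∉ Set.Iic r from hs), if_neg hs, kruzkovFlux,
      max_eq_right (by linarith)]
    ring

end Representation

section Kinetic

theorem abs_kruzkovFlux_le {B r : ℝ} (hr : |r| ≤ B) (s : ℝ) :
    |kruzkovFlux s r| ≤ |s| * (B + |s|) + (B + |s|) ^ 2 / 2 := by
  have hB : 0 ≤ B := (abs_nonneg r).trans hr
  have h1 : |max (r - s) 0| ≤ B + |s| := by
    rw [abs_of_nonneg (le_max_right _ _)]
    exact max_le (by linarith [le_abs_self r, neg_abs_le s]) (by positivity)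
  have h2 : max (r - s) 0 ^ 2 ≤ (B + |s|) ^ 2 := by
    rw [← sq_abs]; exact pow_le_pow_left₀ (abs_nonneg _) h1 2
  refine (abs_add_le _ _).trans (add_le_add ?_ ?_)
  · rw [abs_mul]; exact mul_le_mul_of_nonneg_left h1 (abs_nonneg _)
  · rw [abs_of_nonneg (by positivity)]; linarith

theorem measurable_kinetic_indicator {u : ℝ × ℝ → ℝ} (hu : Measurable u) :
    Measurable fun p : ℝ × ℝ × ℝ => (if p.2.2 ≤ u (p.1, p.2.1) then (1 : ℝ) else 0) :=
  Measurable.ite (measurableSet_le (by fun_prop) (by fun_prop)) measurable_const measurable_const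

theorem abs_ite_one_zero_le (P : Prop) [Decidable P] : |(if P then (1 : ℝ) else 0)| ≤ 1 := by
  split_ifs <;> simp

theorem setIntegral_kinetic_eq {T : ℝ} {φ : ℝ × ℝ × ℝ → ℝ} (hφ : IsTestFun (SlabExt1 T) φ)
    (w : ℝ × ℝ × ℝ → ℝ) :
    ∫ p in SlabExt1 T, w p * (fderiv ℝ φ p (1, 0, 0) + p.2.2 * fderiv ℝ φ p (0, 1, 0))
      = ∫ p, w p * (fderiv ℝ φ p (1, 0, 0) + p.2.2 * fderiv ℝ φ p (0, 1, 0)) :=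
  setIntegral_eq_integral_of_forall_compl_eq_zero fun p hp => by
    rw [(hφ.fderiv_apply (1, 0, 0)).eq_zero_of_notMem hp,
      (hφ.fderiv_apply (0, 1, 0)).eq_zero_of_notMem hp]
    ring

theorem integrable_kinetic {T : ℝ} {φ : ℝ × ℝ × ℝ → ℝ} (hφ : IsTestFun (SlabExt1 T) φ)
    {u : ℝ × ℝ → ℝ} (hu : Measurable u) :
    Integrable (fun p : ℝ × ℝ × ℝ => (if p.2.2 ≤ u (p.1, p.2.1) then (1 : ℝ) else 0)
      * (fderiv ℝ φ p (1, 0, 0) + p.2.2 * fderiv ℝ φ p (0, 1, 0))) volume :=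
  ((hφ.fderiv_apply (1, 0, 0)).add (((hφ.fderiv_apply (0, 1, 0))).mul_left
    (g := fun p => p.2.2) (contDiff_snd.comp contDiff_snd))).integrable_mul
    (measurable_kinetic_indicator hu) fun _ _ => abs_ite_one_zero_le _

/-- The kinetic equation for the Riemann invariant `m/ρ + κρ` when `K` has nonempty interior. -/
theorem IsEntropySolK.exists_kinetic_of_lt {c M T : ℝ} (hc : 0 < c) (hcM : c < M) (hT : 0 < T)
    {U : ℝ × ℝ → ℝ × ℝ} (hU : IsEntropySolK c M T U) {κ : ℝ} (hκ : κ ^ 2 = 1) :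
    ∃ μ : Measure (ℝ × ℝ × ℝ), IsLocallyFiniteMeasure μ ∧
      ∀ φ : ℝ × ℝ × ℝ → ℝ, IsTestFun (SlabExt1 T) φ →
        ∫ p in SlabExt1 T, (if p.2.2 ≤ riemannInv κ (U (p.1, p.2.1)) then (1 : ℝ) else 0)
            * (fderiv ℝ φ p (1, 0, 0) + p.2.2 * fderiv ℝ φ p (0, 1, 0))
          = ∫ p, fderiv ℝ φ p (0, 0, 1) ∂μ := by
  obtain ⟨B, hB0, hB⟩ := exists_bounds_Kset (M := M) hc κ
  have hUm : Measurable U := hU.1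
  set C : ℝ := 1 / c ^ 2 with hCdef
  have hC : 1 ≤ C * c ^ 2 := by rw [hCdef]; field_simp; rfl
  set a : ℝ × ℝ × ℝ → ℝ := fun p =>
    max (riemannInv κ (U (p.1, p.2.1)) - p.2.2) 0 + C * eulerEnergy (U (p.1, p.2.1)) with ha
  set b : ℝ × ℝ × ℝ → ℝ := fun p =>
    kruzkovFlux p.2.2 (riemannInv κ (U (p.1, p.2.1))) + C * eulerEnergyFlux (U (p.1, p.2.1))
    with hb
  have ham : Measurable a := by fun_prop
  have hbm : Measurable b := by unfold b kruzkovFlux; fun_prop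
  have hCB : ∀ y, |y| ≤ B → |C * y| ≤ |C| * B := fun y hy => by
    rw [abs_mul]; exact mul_le_mul_of_nonneg_left hy (abs_nonneg _)
  set N : ℝ → ℝ := fun s => B + |s| + |C| * B with hN
  set L : ℝ → ℝ := fun s => |s| * (B + |s|) + (B + |s|) ^ 2 / 2 + |C| * B with hL
  have hNc : Continuous N := by fun_prop
  have hLc : Continuous L := by fun_prop
  have haN : ∀ p, |a p| ≤ N p.2.2 := fun p => by
    obtain ⟨b1, b2, -⟩ := hB _ (hU.2.1 (p.1, p.2.1))
    refine (abs_add_le _ _).trans (add_le_add ?_ (hCB _ b2))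
    rw [abs_of_nonneg (le_max_right _ _)]
    exact max_le (by linarith [(abs_le.1 b1).2, neg_abs_le p.2.2]) (by positivity)
  have hbL : ∀ p, |b p| ≤ L p.2.2 := fun p => by
    obtain ⟨b1, -, b3⟩ := hB _ (hU.2.1 (p.1, p.2.1))
    exact (abs_add_le _ _).trans (add_le_add (abs_kruzkovFlux_le b1 _) (hCB _ b3))
  obtain ⟨μ, hμ, hμφ⟩ := exists_measure_of_dissipative hT ham hbm hNc hLc haN hbL
    fun s φ hφ hφ0 => hU.dissipation_posPart hc hcM hκ hC s hφ hφ0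
  refine ⟨μ, hμ, fun φ hφ => ?_⟩
  have hφt := hφ.fderiv_apply (1, 0, 0)
  have hφx := hφ.fderiv_apply (0, 1, 0)
  have hφ2 : ContDiff ℝ 2 φ := contDiff_infty.1 hφ.1 2
  rw [setIntegral_kinetic_eq hφ, hμφ _ (hφ.fderiv_apply _),
    integral_eq_integral_fiber
      (integrable_kinetic (u := fun q => riemannInv κ (U q)) hφ (by fun_prop))]
  simp only [fderiv_fderiv_apply_comm hφ2 _ (0, 0, 1)]
  have hfib := integral_eq_integral_fiber
    (((hφt.fderiv_apply (0, 0, 1)).integrable_mul_of_le ham hNc haN).add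
      ((hφx.fderiv_apply (0, 0, 1)).integrable_mul_of_le hbm hLc hbL))
  refine Eq.trans ?_ hfib.symm
  refine integral_congr_ae (ae_of_all _ fun q => ?_)
  have h := integral_posPart_mul_deriv (hφt.contDiff_fiber q) (hφx.contDiff_fiber q)
    (hφt.hasCompactSupport_fiber q) (hφx.hasCompactSupport_fiber q) (riemannInv κ (U q))
    (C * eulerEnergy (U q)) (C * eulerEnergyFlux (U q))
  simp only [(hasDerivAt_fiber hφt.differentiable q _).deriv,
    (hasDerivAt_fiber hφx.differentiable q _).deriv] at h
  exact h.symm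

end Kinetic

section WeakDerivative

open scoped Convolution

variable {Ω : Set (ℝ × ℝ)} {u : ℝ × ℝ → ℝ} {B : ℝ}

/-- A bounded function with a vanishing weak directional derivative keeps this property after
composition with a smooth function. -/
theorem integral_comp_mul_fderiv_eq_zero (hΩ : IsOpen Ω) (hu : Measurable u)
    (hB : ∀ p, |u p| ≤ B) {e : ℝ × ℝ}
    (h : ∀ ψ, IsTestFun Ω ψ → ∫ p, u p * fderiv ℝ ψ p e = 0)
    {F : ℝ → ℝ} (hF : ContDiff ℝ (⊤ : ℕ∞) F) {ψ : ℝ × ℝ → ℝ} (hψ : IsTestFun Ω ψ) :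
    ∫ p, F (u p) * fderiv ℝ ψ p e = 0 := by
  have hB0 : 0 ≤ B := (abs_nonneg _).trans (hB 0)
  have huL : LocallyIntegrable u volume :=
    (locallyIntegrable_const B).mono hu.aestronglyMeasurable (ae_of_all _ fun p => by
      rw [Real.norm_eq_abs, Real.norm_eq_abs, abs_of_nonneg hB0]; exact hB p)
  let b : ℕ → ContDiffBump (0 : ℝ × ℝ) := fun n =>
    ⟨1 / ((n : ℝ) + 1) / 2, 1 / ((n : ℝ) + 1), by positivity, half_lt_self (by positivity)⟩
  set v : ℕ → ℝ × ℝ → ℝ := fun n =>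
    (b n).normed volume ⋆[ContinuousLinearMap.lsmul ℝ ℝ, volume] u with hv
  have hlim : ∀ᵐ p, Tendsto (fun n => v n p) atTop (𝓝 (u p)) :=
    ContDiffBump.ae_convolution_tendsto_right_of_locallyIntegrable (K := 2)
      tendsto_one_div_add_atTop_nhds_zero_nat
      (Eventually.of_forall fun n => by change _ ≤ 2 * (_ / 2); linarith) huL
  have hvs : ∀ n, ContDiff ℝ (⊤ : ℕ∞) (v n) := fun n =>
    (b n).hasCompactSupport_normed.contDiff_convolution_left _ (b n).contDiff_normed huL
  have hvB : ∀ n p, |v n p| ≤ B := fun n p => by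
    have hi := (b n).integrable_normed (μ := (volume : Measure (ℝ × ℝ)))
    have h1 := norm_integral_le_of_norm_le (hi.mul_const B)
      (f := fun t => (b n).normed volume t • u (p - t)) (ae_of_all _ fun t => by
        rw [smul_eq_mul, Real.norm_eq_abs, abs_mul, abs_of_nonneg ((b n).nonneg_normed t)]
        exact mul_le_mul_of_nonneg_left (hB _) ((b n).nonneg_normed t))
    rwa [integral_mul_const, (b n).integral_normed, one_mul] at h1
  have hvd : ∀ (n : ℕ) (p : ℝ × ℝ), Metric.closedBall p (1 / ((n : ℝ) + 1)) ⊆ Ω →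
      fderiv ℝ (v n) p e = 0 := fun n p hp => by
    have hbs : ContDiff ℝ (⊤ : ℕ∞) ((b n).normed (volume : Measure (ℝ × ℝ))) :=
      (b n).contDiff_normed
    have hbc := (b n).hasCompactSupport_normed (μ := (volume : Measure (ℝ × ℝ)))
    have hb1 : ContDiff ℝ 1 ((b n).normed (volume : Measure (ℝ × ℝ))) := hbs.of_le (by simp)
    have hd := hbc.hasFDerivAt_convolution_right (ContinuousLinearMap.lsmul ℝ ℝ).flip huL hb1 p
    rw [convolution_flip] at hd
    rw [show fderiv ℝ (v n) p = _ from hd.fderiv, convolution_precompR_apply _ huL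
      (hbc.fderiv ℝ) (hb1.continuous_fderiv one_ne_zero), convolution_def]
    have htest : IsTestFun Ω fun t => (b n).normed volume (p - t) := by
      have hsub : tsupport (fun t => (b n).normed volume (p - t))
          ⊆ Metric.closedBall p (1 / ((n : ℝ) + 1)) := by
        refine closure_minimal (fun t ht => ?_) Metric.isClosed_closedBall
        have h1 := subset_tsupport ((b n).normed volume) ht
        rw [(b n).tsupport_normed_eq] at h1
        rw [mem_closedBall_iff_norm] at h1 ⊢
        rwa [sub_zero, norm_sub_rev] at h1
      exact ⟨hbs.comp (contDiff_const.sub contDiff_id),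
        HasCompactSupport.of_support_subset_isCompact (isCompact_closedBall _ _)
          ((subset_tsupport _).trans hsub), hsub.trans hp⟩
    have h0 := h _ htest
    have hchain : ∀ t, fderiv ℝ (fun t => (b n).normed volume (p - t)) t e
        = -fderiv ℝ ((b n).normed volume) (p - t) e := fun t => by
      have h1 := ((hb1.differentiable one_ne_zero (p - t)).hasFDerivAt.comp t
        ((hasFDerivAt_id t).const_sub p)).fderiv
      rw [Function.comp_def] at h1
      rw [h1]
      simp
    simp only [hchain, mul_neg, integral_neg, neg_eq_zero] at h0
    rw [← h0]
    refine integral_congr_ae (ae_of_all _ fun t => ?_)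
    simp [mul_comm]
  have hzero : ∀ᶠ n in atTop, ∫ p, F (v n p) * fderiv ℝ ψ p e = 0 := by
    obtain ⟨δ, hδ, hδΩ⟩ := hψ.2.1.isCompact.exists_cthickening_subset_open hΩ hψ.2.2
    have hev : ∀ᶠ n : ℕ in atTop, 1 / ((n : ℝ) + 1) < δ :=
      tendsto_one_div_add_atTop_nhds_zero_nat.eventually (gt_mem_nhds hδ)
    filter_upwards [hev] with n hn
    have hFv : ContDiff ℝ (⊤ : ℕ∞) fun p => F (v n p) := hF.comp (hvs n)
    have hprod := hψ.mul_left hFv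
    rw [← integral_fderiv_apply_eq_zero (μ := volume) (hprod.1.of_le (by simp)) hprod.2.1 e]
    refine integral_congr_ae (ae_of_all _ fun p => ?_)
    have h1 := ((hF.differentiable (by simp) (v n p)).hasDerivAt.comp_hasFDerivAt p
      ((hvs n).differentiable (by simp) p).hasFDerivAt).fun_mul (hψ.differentiable p).hasFDerivAt
    beta_reduce
    rw [show fderiv ℝ (fun p => F (v n p) * ψ p) p = _ from h1.fderiv]
    by_cases hp : p ∈ tsupport ψ
    · have h2 := hvd n p ((Metric.closedBall_subset_cthickening hp _).trans
        ((Metric.cthickening_mono hn.le _).trans hδΩ))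
      simp [h2]
    · simp [image_eq_zero_of_notMem_tsupport hp]
  obtain ⟨D, hD⟩ := (isCompact_Icc (a := -B) (b := B)).exists_bound_of_continuousOn
    hF.continuous.continuousOn
  have hψe := hψ.fderiv_apply e
  refine tendsto_nhds_unique (tendsto_integral_of_dominated_convergence
    (F := fun n p => F (v n p) * fderiv ℝ ψ p e) (fun p => D * |fderiv ℝ ψ p e|)
    (fun n => ((hF.continuous.comp (hvs n).continuous).mul
      hψe.continuous).aestronglyMeasurable) (hψe.integrable.abs.const_mul D)
    (fun n => ae_of_all _ fun p => ?_) ?_)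
    (tendsto_const_nhds.congr' (hzero.mono fun n hn => hn.symm))
  · rw [norm_mul]
    exact mul_le_mul_of_nonneg_right (hD _ (abs_le.1 (hvB n p))) (norm_nonneg _)
  · filter_upwards [hlim] with p hp
    exact ((hF.continuous.tendsto _).comp hp).mul_const _

theorem integral_ite_mul_fderiv_eq_zero (hΩ : IsOpen Ω) (hu : Measurable u)
    (hB : ∀ p, |u p| ≤ B) {e : ℝ × ℝ}
    (h : ∀ ψ, IsTestFun Ω ψ → ∫ p, u p * fderiv ℝ ψ p e = 0) (s : ℝ)
    {ψ : ℝ × ℝ → ℝ} (hψ : IsTestFun Ω ψ) :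
    ∫ p, (if s ≤ u p then 1 else 0) * fderiv ℝ ψ p e = 0 := by
  have hψe := hψ.fderiv_apply e
  have hc : ∀ n, ContDiff ℝ (⊤ : ℕ∞) fun y => 1 - cutoff n (s - y) := fun n =>
    contDiff_const.sub ((contDiff_cutoff n).comp (contDiff_const.sub contDiff_id))
  refine tendsto_nhds_unique (tendsto_integral_of_dominated_convergence
    (F := fun n p => (1 - cutoff n (s - u p)) * fderiv ℝ ψ p e) (fun p => |fderiv ℝ ψ p e|)
    (fun n => ?_) hψe.integrable.abs (fun n => ae_of_all _ fun p => ?_)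
    (ae_of_all _ fun p => ?_)) (tendsto_const_nhds.congr fun n =>
      (integral_comp_mul_fderiv_eq_zero hΩ hu hB h (hc n) hψ).symm)
  · exact (((hc n).continuous.measurable.comp hu).mul
      hψe.continuous.measurable).aestronglyMeasurable
  · rw [norm_mul, Real.norm_eq_abs, Real.norm_eq_abs]
    refine mul_le_of_le_one_left (abs_nonneg _) (abs_le.2 ?_)
    constructor <;> linarith [cutoff_nonneg n (s - u p), cutoff_le_one n (s - u p)]
  · convert ((tendsto_cutoff (s - u p)).const_sub 1).mul_const (fderiv ℝ ψ p e) using 2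
    by_cases hs : s ≤ u p
    · simp [hs, not_lt.2 hs]
    · simp [hs, not_le.1 hs]

end WeakDerivative

section Degenerate

theorem isOpen_Slab1 (T : ℝ) : IsOpen (Slab1 T) := isOpen_Ioo.preimage continuous_fst

/-- When `K` is a segment of constant density, the kinetic equation has no source. -/
theorem IsEntropySolK.kinetic_of_eq {M T : ℝ} (hM : 0 < M) {U : ℝ × ℝ → ℝ × ℝ}
    (hU : IsEntropySolK M M T U) (κ : ℝ) {φ : ℝ × ℝ × ℝ → ℝ} (hφ : IsTestFun (SlabExt1 T) φ) :
    ∫ p in SlabExt1 T, (if p.2.2 ≤ riemannInv κ (U (p.1, p.2.1)) then (1 : ℝ) else 0)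
      * (fderiv ℝ φ p (1, 0, 0) + p.2.2 * fderiv ℝ φ p (0, 1, 0)) = 0 := by
  obtain ⟨B, hB0, hB⟩ := exists_bounds_Kset (M := M) hM κ
  have hUm : Measurable U := hU.1
  have hρ : ∀ p, (U p).1 = M := fun p =>
    le_antisymm ((le_abs_self _).trans ((norm_fst_le (U p)).trans (hU.2.1 p).1)) (hU.2.1 p).2
  have hmM : ∀ p, |(U p).2| ≤ M := fun p => (norm_snd_le (U p)).trans (hU.2.1 p).1
  have hmm : Measurable fun p => (U p).2 := by fun_prop
  have hdiv : ∀ ψ, IsTestFun (Slab1 T) ψ → ∀ e, ∫ p, fderiv ℝ ψ p e = 0 := fun ψ hψ e =>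
    integral_fderiv_apply_eq_zero (hψ.1.of_le (by simp)) hψ.2.1 e
  have hslab : ∀ ψ, IsTestFun (Slab1 T) ψ → ∀ f g : ℝ × ℝ → ℝ,
      ∫ p in Slab1 T, (f p * fderiv ℝ ψ p (1, 0) + g p * fderiv ℝ ψ p (0, 1))
        = ∫ p, (f p * fderiv ℝ ψ p (1, 0) + g p * fderiv ℝ ψ p (0, 1)) := fun ψ hψ f g =>
    setIntegral_eq_integral_of_forall_compl_eq_zero fun p hp => by
      rw [(hψ.fderiv_apply (1, 0)).eq_zero_of_notMem hp,
        (hψ.fderiv_apply (0, 1)).eq_zero_of_notMem hp]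
      ring
  have hi : ∀ ψ, IsTestFun (Slab1 T) ψ → ∀ e, Integrable (fun p => (U p).2 * fderiv ℝ ψ p e)
      volume := fun ψ hψ e => (hψ.fderiv_apply e).integrable_mul hmm fun p _ => hmM p
  have hx : ∀ ψ, IsTestFun (Slab1 T) ψ → ∫ p, (U p).2 * fderiv ℝ ψ p (0, 1) = 0 :=
    fun ψ hψ => by
    have h := (hU.2.2.1 ψ hψ).1
    rw [hslab ψ hψ] at h
    simp only [hρ] at h
    rwa [integral_add ((hψ.fderiv_apply (1, 0)).integrable.const_mul M) (hi ψ hψ _),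
      integral_const_mul, hdiv ψ hψ, mul_zero, zero_add] at h
  have hxx : ∀ ψ, IsTestFun (Slab1 T) ψ →
      ∫ p, ((U p).2 ^ 2 / M + M ^ 3 / 3) * fderiv ℝ ψ p (0, 1) = 0 := fun ψ hψ =>
    integral_comp_mul_fderiv_eq_zero (F := fun y => y ^ 2 / M + M ^ 3 / 3) (isOpen_Slab1 T) hmm
      hmM hx (((contDiff_id.pow 2).div_const M).add contDiff_const) hψ
  have ht : ∀ ψ, IsTestFun (Slab1 T) ψ → ∫ p, (U p).2 * fderiv ℝ ψ p (1, 0) = 0 :=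
    fun ψ hψ => by
    have h := (hU.2.2.1 ψ hψ).2
    rw [hslab ψ hψ (fun p => (U p).2) (fun p => (U p).2 ^ 2 / (U p).1 + (U p).1 ^ 3 / 3)] at h
    simp only [hρ] at h
    rwa [integral_add (hi ψ hψ _) ((hψ.fderiv_apply (0, 1)).integrable_mul
      (B := M ^ 2 / M + M ^ 3 / 3) (by fun_prop) fun p _ => ?_), hxx ψ hψ, add_zero] at h
    rw [abs_of_nonneg (by positivity), ← sq_abs]
    gcongr
    exact hmM p
  have hr : ∀ {e}, (∀ ψ, IsTestFun (Slab1 T) ψ → ∫ p, (U p).2 * fderiv ℝ ψ p e = 0) →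
      ∀ ψ, IsTestFun (Slab1 T) ψ → ∫ p, riemannInv κ (U p) * fderiv ℝ ψ p e = 0 :=
    fun {e} he ψ hψ => integral_comp_mul_fderiv_eq_zero (F := fun y => y / M + κ * M)
      (isOpen_Slab1 T) hmm hmM he ((contDiff_id.div_const M).add contDiff_const) hψ |>.symm.trans
        (by simp only [riemannInv, hρ]) |>.symm
  have hrm : Measurable fun p => riemannInv κ (U p) := by fun_prop
  have hrB : ∀ p, |riemannInv κ (U p)| ≤ B := fun p => (hB _ (hU.2.1 p)).1
  rw [setIntegral_kinetic_eq hφ, integral_eq_integral_lastSlice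
    (integrable_kinetic (u := fun q => riemannInv κ (U q)) hφ (by fun_prop))]
  refine integral_eq_zero_of_ae (ae_of_all _ fun s => ?_)
  have hs : IsTestFun (Slab1 T) fun q : ℝ × ℝ => φ (q.1, q.2, s) :=
    IsTestFun.lastSlice (S := Set.Ioo 0 T) hφ s
  have h1 := integral_ite_mul_fderiv_eq_zero (isOpen_Slab1 T) hrm hrB (hr ht) s hs
  have h2 := integral_ite_mul_fderiv_eq_zero (isOpen_Slab1 T) hrm hrB (hr hx) s hs
  have hite : Measurable fun p => (if s ≤ riemannInv κ (U p) then (1 : ℝ) else 0) :=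
    Measurable.ite (measurableSet_le measurable_const hrm) measurable_const measurable_const
  have hadd := integral_add
    ((hs.fderiv_apply (1, 0)).integrable_mul (μ := volume) hite fun _ _ => abs_ite_one_zero_le _)
    (((hs.fderiv_apply (0, 1)).integrable_mul (μ := volume) hite
      fun _ _ => abs_ite_one_zero_le _).const_mul s)
  rw [integral_const_mul, h1, h2, mul_zero, add_zero] at hadd
  refine Eq.trans ?_ hadd
  refine integral_congr_ae (ae_of_all _ fun q => ?_)
  simp only [fderiv_lastSlice_apply hφ.differentiable]
  ring

/-- The kinetic equation for the Riemann invariant `m/ρ + κρ`. -/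
theorem IsEntropySolK.exists_kinetic {c M T : ℝ} (hc : 0 < c) (hcM : c ≤ M) (hT : 0 < T)
    {U : ℝ × ℝ → ℝ × ℝ} (hU : IsEntropySolK c M T U) {κ : ℝ} (hκ : κ ^ 2 = 1) :
    ∃ μ0 μ1 : LocSigned (ℝ × ℝ × ℝ), (μ1.pos = 0 ∨ μ1.neg = 0) ∧
      ∀ φ : ℝ × ℝ × ℝ → ℝ, IsTestFun (SlabExt1 T) φ →
        (∫ p in SlabExt1 T,
          (if p.2.2 ≤ riemannInv κ (U (p.1, p.2.1)) then (1 : ℝ) else 0)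
            * (fderiv ℝ φ p (1, 0, 0) + p.2.2 * fderiv ℝ φ p (0, 1, 0)))
          = μ1.integral (fun p => fderiv ℝ φ p (0, 0, 1)) - μ0.integral φ := by
  have hμ : ∃ μ : Measure (ℝ × ℝ × ℝ), IsLocallyFiniteMeasure μ ∧
      ∀ φ : ℝ × ℝ × ℝ → ℝ, IsTestFun (SlabExt1 T) φ →
        ∫ p in SlabExt1 T, (if p.2.2 ≤ riemannInv κ (U (p.1, p.2.1)) then (1 : ℝ) else 0)
            * (fderiv ℝ φ p (1, 0, 0) + p.2.2 * fderiv ℝ φ p (0, 1, 0))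
          = ∫ p, fderiv ℝ φ p (0, 0, 1) ∂μ := by
    rcases hcM.lt_or_eq with hlt | rfl
    · exact hU.exists_kinetic_of_lt hc hlt hT hκ
    · exact ⟨0, inferInstance, fun φ hφ => by rw [hU.kinetic_of_eq hc κ hφ, integral_zero_measure]⟩
  obtain ⟨μ, hμLF, hμφ⟩ := hμ
  refine ⟨⟨0, 0, inferInstance, inferInstance, Measure.MutuallySingular.zero_right⟩,
    ⟨μ, 0, hμLF, inferInstance, Measure.MutuallySingular.zero_right⟩, Or.inr rfl, fun φ hφ => ?_⟩
  rw [hμφ φ hφ]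
  simp [LocSigned.integral]

end Degenerate

/-- The Riemann invariants of an entropy solution in `K` of the
isentropic Euler system with `γ = 3` satisfy kinetic equations whose measures
`μ1, σ1` have a definite sign. -/
theorem statement15 (c M T : ℝ) (hc : 0 < c) (hcM : c ≤ M) (hT : 0 < T)
    (U : ℝ × ℝ → ℝ × ℝ) (hU : IsEntropySolK c M T U) :
    ∃ μ0 σ0 μ1 σ1 : LocSigned (ℝ × ℝ × ℝ),
      (μ1.pos = 0 ∨ μ1.neg = 0) ∧ (σ1.pos = 0 ∨ σ1.neg = 0) ∧
      (∀ φ : ℝ × ℝ × ℝ → ℝ, IsTestFun (SlabExt1 T) φ →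
        (∫ p in SlabExt1 T,
          (if p.2.2 ≤ zInv U (p.1, p.2.1) then (1 : ℝ) else 0)
            * (fderiv ℝ φ p (1, 0, 0) + p.2.2 * fderiv ℝ φ p (0, 1, 0)))
          = μ1.integral (fun p => fderiv ℝ φ p (0, 0, 1)) - μ0.integral φ) ∧
      (∀ φ : ℝ × ℝ × ℝ → ℝ, IsTestFun (SlabExt1 T) φ →
        (∫ p in SlabExt1 T,
          (if p.2.2 ≤ wInv U (p.1, p.2.1) then (1 : ℝ) else 0)
            * (fderiv ℝ φ p (1, 0, 0) + p.2.2 * fderiv ℝ φ p (0, 1, 0)))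
          = σ1.integral (fun p => fderiv ℝ φ p (0, 0, 1)) - σ0.integral φ) := by
  obtain ⟨μ0, μ1, hμ, hz⟩ := hU.exists_kinetic hc hcM hT (κ := 1) (by norm_num)
  obtain ⟨σ0, σ1, hσ, hw⟩ := hU.exists_kinetic hc hcM hT (κ := -1) (by norm_num)
  refine ⟨μ0, σ0, μ1, σ1, hμ, hσ, fun φ hφ => ?_, fun φ hφ => ?_⟩
  · convert hz φ hφ using 7
    simp [riemannInv, zInv]
  · convert hw φ hφ using 7
    simp [riemannInv, wInv, sub_eq_add_neg]
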